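/- Let r = 1 and suppose θ* ∈ ℝ^n has k ≥ 1 jumps with signs 𝔯_1,…,𝔯_k (𝔯_0 = 𝔯_{k+1} = 0) and constant-piece lengths n_0, n_1, …, n_k. With λ* as defined in the context, there is a universal constant C such that for every λ ≥ λ*, R(θ̂^{(1)}_λ, θ*) ≤ C σ² ( Δ_1(θ*) + ((λ − λ*)²/n)·Σ_{i=0}^k 1{𝔯_i ≠ 𝔯_{i+1}}/n_i ). Moreover, if θ* satisfies the minimum length condition with constant c, then for every λ ≥ λ*, R(θ̂^{(1)}_λ, θ*) ≤ C(c) σ² ( ((k+1)/n)·log(en/(k+1)) + (λ − λ*)²·((k+1)/n²)·Σ_{i=0}^k 1{𝔯_i ≠ 𝔯_{i+1}} ), where C(c) depends only on c. -/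

import Mathlib

open MeasureTheory ProbabilityTheory
open scoped BigOperators

noncomputable section

/-- Zero-padding of a finite vector to a sequence on `ℕ`. -/
def pad {n : ℕ} (θ : Fin n → ℝ) : ℕ → ℝ := fun t => if h : t < n then θ ⟨t, h⟩ else 0

/-- First-order forward difference of a sequence. -/
def dseq (f : ℕ → ℝ) : ℕ → ℝ := fun t => f (t + 1) - f t

/-- `DD r θ t` is the `t`-th entry (0-indexed) of the `r`-th order difference `D^{(r)} θ`
of the vector `θ ∈ ℝ^n`; only the entries `t < n - r` are meaningful. -/
def DD (r : ℕ) {n : ℕ} (θ : Fin n → ℝ) : ℕ → ℝ := dseq^[r] (pad θ)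

/-- The ℓ¹ norm `‖D^{(r)} θ‖₁`. -/
def Dl1 (r : ℕ) {n : ℕ} (θ : Fin n → ℝ) : ℝ := ∑ t ∈ Finset.range (n - r), |DD r θ t|

/-- The number of nonzero entries `‖D^{(r)} θ‖₀`. -/
def Dl0 (r : ℕ) {n : ℕ} (θ : Fin n → ℝ) : ℕ :=
  ((Finset.range (n - r)).filter fun t => DD r θ t ≠ 0).card

/-- Squared Euclidean norm. -/
def sqnorm {n : ℕ} (x : Fin n → ℝ) : ℝ := ∑ i, x i ^ 2

/-- Euclidean norm. -/
def eunorm {n : ℕ} (x : Fin n → ℝ) : ℝ := Real.sqrt (sqnorm x)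

/-- `V^{(r)}(θ) = n^{r-1} ‖D^{(r)} θ‖₁`. -/
def Vr (r : ℕ) {n : ℕ} (θ : Fin n → ℝ) : ℝ := (n : ℝ) ^ ((r : ℤ) - 1) * Dl1 r θ

/-- The constraint set `K^{(r)}(V) = {θ : ‖D^{(r)} θ‖₁ ≤ V n^{1-r}}`. -/
def Kset (r n : ℕ) (V : ℝ) : Set (Fin n → ℝ) := {θ | Dl1 r θ ≤ V * (n : ℝ) ^ (1 - (r : ℤ))}

/-- `est` is a least-squares projection onto the set `K`. -/
def IsProjOn {n : ℕ} (est : (Fin n → ℝ) → Fin n → ℝ) (K : Set (Fin n → ℝ)) : Prop :=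
  ∀ y, est y ∈ K ∧ ∀ θ ∈ K, sqnorm (y - est y) ≤ sqnorm (y - θ)

/-- `est` is the penalized trend filtering estimator of order `r` with noise level `σ`
and tuning parameter `lam`: it minimizes `½‖y - θ‖² + σ n^{r-1} lam ‖D^{(r)} θ‖₁`. -/
def IsPenEst (r : ℕ) {n : ℕ} (σ lam : ℝ) (est : (Fin n → ℝ) → Fin n → ℝ) : Prop :=
  ∀ y θ, 1 / 2 * sqnorm (y - est y) + σ * (n : ℝ) ^ ((r : ℤ) - 1) * lam * Dl1 r (est y) ≤
    1 / 2 * sqnorm (y - θ) + σ * (n : ℝ) ^ ((r : ℤ) - 1) * lam * Dl1 r θ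

/-- The Gaussian measure `N_n(0, σ² I_n)` on `ℝ^n`. -/
def gaussVec (n : ℕ) (σ : ℝ) : Measure (Fin n → ℝ) :=
  Measure.pi fun _ => gaussianReal 0 (σ ^ 2).toNNReal

/-- The risk `R(θ̂, θ*) = (1/n) E ‖θ̂(θ* + ξ) - θ*‖²` for `ξ ∼ N_n(0, σ² I_n)`. -/
def risk {n : ℕ} (σ : ℝ) (est : (Fin n → ℝ) → Fin n → ℝ) (θs : Fin n → ℝ) : ℝ :=
  1 / (n : ℝ) * ∫ ξ, sqnorm (est (θs + ξ) - θs) ∂gaussVec n σ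

/-- `j` (with signs `sg`) enumerates, in increasing order and paper (1-indexed) convention,
exactly the `r`-th order knots of `θ ∈ ℝ^n`; an index `2 ≤ m ≤ n - r + 1` is a knot when
`(D^{(r-1)}θ)_{m-1} ≠ (D^{(r-1)}θ)_m` (1-indexed entries), and its sign is `+1` when
`(D^{(r-1)}θ)_{m-1} < (D^{(r-1)}θ)_m` and `-1` otherwise. -/
def IsKnotSeq (r n : ℕ) (θ : Fin n → ℝ) (k : ℕ) (j : Fin k → ℕ) (sg : Fin k → ℝ) : Prop :=
  StrictMono j ∧ (∀ i, 2 ≤ j i ∧ j i ≤ n - r + 1) ∧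
    (∀ m : ℕ, 2 ≤ m → m ≤ n - r + 1 →
      (DD (r - 1) θ (m - 2) ≠ DD (r - 1) θ (m - 1) ↔ ∃ i, j i = m)) ∧
    ∀ i, sg i = if DD (r - 1) θ (j i - 2) < DD (r - 1) θ (j i - 1) then 1 else -1

/-- Extended knot sequence: `jext 0 = j_0 = 1`, `jext i = j_i` for `1 ≤ i ≤ k`, and
`jext (k+1) = j_{k+1} = n - r + 2`. -/
def jext (n r k : ℕ) (j : Fin k → ℕ) : ℕ → ℕ := fun i =>
  if i = 0 then 1 else if h : i - 1 < k then j ⟨i - 1, h⟩ else n - r + 2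

/-- Extended sign sequence: `sgext i = 𝔯_i` for `1 ≤ i ≤ k` and `0` otherwise. -/
def sgext (k : ℕ) (sg : Fin k → ℝ) : ℕ → ℝ := fun i =>
  if h : 0 < i ∧ i - 1 < k then sg ⟨i - 1, h.2⟩ else 0

/-- The lengths `n_0 = j_1 + r - 2`, `n_i = j_{i+1} - j_i` (`1 ≤ i ≤ k-1`),
`n_k = n - r + 2 - j_k`. -/
def nlen (n r k : ℕ) (j : Fin k → ℕ) : ℕ → ℕ := fun i =>
  if i = 0 then jext n r k j 1 + r - 2 else jext n r k j (i + 1) - jext n r k j i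

/-- `n_{i*} = min(n_i, n/(k+1))`. -/
def nstar (n r k : ℕ) (j : Fin k → ℕ) (i : ℕ) : ℝ :=
  min (nlen n r k j i : ℝ) ((n : ℝ) / ((k : ℝ) + 1))

/-- `δ_r(θ)²` defined from the knot data of `θ`. -/
def deltaSq (n r k : ℕ) (j : Fin k → ℕ) (sg : Fin k → ℝ) : ℝ :=
  nstar n r k j 0 ^ (1 - 2 * (r : ℤ)) + nstar n r k j k ^ (1 - 2 * (r : ℤ)) +
    ∑ i ∈ Finset.Ico 1 k,
      if sgext k sg i ≠ sgext k sg (i + 1) then nstar n r k j i ^ (1 - 2 * (r : ℤ)) else 0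

/-- `Δ_r(θ)` defined from the knot data of `θ`. -/
def DeltaR (n r k : ℕ) (j : Fin k → ℕ) (sg : Fin k → ℝ) : ℝ :=
  ((k : ℝ) + 1) / (n : ℝ) * Real.log (Real.exp 1 * (n : ℝ) / ((k : ℝ) + 1)) +
    deltaSq n r k j sg / (n : ℝ) * ((n : ℝ) / ((k : ℝ) + 1)) ^ (2 * (r : ℤ) - 1) *
      Real.log (Real.exp 1 * (n : ℝ) / ((k : ℝ) + 1)) +
    (Real.sqrt (deltaSq n r k j sg) / Real.sqrt (n : ℝ)) ^ ((1 : ℝ) / (r : ℝ))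

/-- The minimum length condition with constant `c`: `n_i ≥ c n/(k+1)` for every `0 ≤ i ≤ k`
with `𝔯_i ≠ 𝔯_{i+1}` (where `𝔯_0 = 𝔯_{k+1} = 0`). -/
def MinLen (n r k : ℕ) (j : Fin k → ℕ) (sg : Fin k → ℝ) (c : ℝ) : Prop :=
  ∀ i ≤ k, sgext k sg i ≠ sgext k sg (i + 1) →
    c * (n : ℝ) / ((k : ℝ) + 1) ≤ (nlen n r k j i : ℝ)

/-- The subdifferential of `g` at `θ`. -/
def subdiff {n : ℕ} (g : (Fin n → ℝ) → ℝ) (θ : Fin n → ℝ) : Set (Fin n → ℝ) :=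
  {v | ∀ y, g θ + ∑ i, v i * (y i - θ i) ≤ g y}

/-- `v` is the minimum-norm element of `S`. -/
def IsMinNormIn {n : ℕ} (v : Fin n → ℝ) (S : Set (Fin n → ℝ)) : Prop :=
  v ∈ S ∧ ∀ w ∈ S, eunorm v ≤ eunorm w

/-- `c • S`. -/
def scaleSet {n : ℕ} (c : ℝ) (S : Set (Fin n → ℝ)) : Set (Fin n → ℝ) := (c • ·) '' S

/-- The cone generated by `S`: `⋃_{c ≥ 0} c • S`. -/
def coneOf {n : ℕ} (S : Set (Fin n → ℝ)) : Set (Fin n → ℝ) := ⋃ c ∈ Set.Ici (0 : ℝ), scaleSet c S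

/-- Euclidean distance from a point to a set. -/
def distSet {n : ℕ} (z : Fin n → ℝ) (S : Set (Fin n → ℝ)) : ℝ :=
  sInf ((fun v => eunorm (z - v)) '' S)

/-- Gaussian mean squared distance `D(S) = E dist²(Z, S)`, `Z ∼ N_n(0, I_n)`. -/
def gaussMSD {n : ℕ} (S : Set (Fin n → ℝ)) : ℝ := ∫ z, distSet z S ^ 2 ∂gaussVec n 1

/-- `lam z` is, for each `z`, the minimizer over `λ ≥ 0` of `dist(z, λ S)`. -/
def IsLamFun {n : ℕ} (S : Set (Fin n → ℝ)) (lam : (Fin n → ℝ) → ℝ) : Prop :=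
  ∀ z, 0 ≤ lam z ∧ ∀ μ : ℝ, 0 ≤ μ → distSet z (scaleSet (lam z) S) ≤ distSet z (scaleSet μ S)

/-- Euclidean covering number of `K` at scale `ε`. -/
def covN {n : ℕ} (ε : ℝ) (K : Set (Fin n → ℝ)) : ℕ :=
  sInf {m : ℕ | ∃ a : Fin m → Fin n → ℝ, ∀ x ∈ K, ∃ i, eunorm (x - a i) ≤ ε}

/-- `K` `t`-shatters the (finite) index set `A`. -/
def fatShatters {n : ℕ} (K : Set (Fin n → ℝ)) (t : ℝ) (A : Finset (Fin n)) : Prop :=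
  ∃ h : Fin n → ℝ, ∀ S : Finset (Fin n), S ⊆ A →
    ∃ θ ∈ K, (∀ i ∈ S, θ i ≤ h i) ∧ ∀ i ∈ A, i ∉ S → h i + t ≤ θ i

/-- The fat shattering dimension `v(K, t)`. -/
def fatDim {n : ℕ} (K : Set (Fin n → ℝ)) (t : ℝ) : ℕ :=
  sSup {m : ℕ | ∃ A : Finset (Fin n), A.card = m ∧ fatShatters K t A}

/-- The tangent cone of `K` at `θ`. -/
def tanCone {n : ℕ} (K : Set (Fin n → ℝ)) (θ : Fin n → ℝ) : Set (Fin n → ℝ) :=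
  closure {w | ∃ t : ℝ, 0 ≤ t ∧ ∃ η ∈ K, w = t • (η - θ)}

/-- `V_{a,b}(f) = Σ_{m=a+1}^{b} |f_m - f_{m-1}|` for the (paper 1-indexed) sequence whose
`m`-th entry is `f (m-1)`. -/
def Vab (f : ℕ → ℝ) (a b : ℕ) : ℝ := ∑ t ∈ Finset.Ico (a - 1) (b - 1), |f (t + 1) - f t|

/-- `Acoef r n v j = Σ_{i=j}^n C(r+i-j-1, r-1) v_i` (paper 1-indexed). -/
def Acoef (r n : ℕ) (v : Fin n → ℝ) (jj : ℕ) : ℝ :=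
  ∑ i : Fin n, (if jj ≤ i.1 + 1 then ((r + (i.1 + 1) - jj - 1).choose (r - 1) : ℝ) else 0) * v i

/-- The class `C_r({a_i}, {s_i})`. -/
def Cras (r n : ℕ) (a s : ℕ → ℝ) : Set (Fin n → ℝ) :=
  {θ | (∀ i < r - 1, a i ≤ DD i θ 0 ∧ DD i θ 0 ≤ a i + s i) ∧
    a (r - 1) ≤ DD (r - 1) θ 0 ∧
    (∀ t : ℕ, t + 1 ≤ n - r → DD (r - 1) θ t ≤ DD (r - 1) θ (t + 1)) ∧
    DD (r - 1) θ (n - r) ≤ a (r - 1) + s (r - 1)}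

/-- The class `C_r(a, V) = {θ : a ≤ (D^{(r-1)}θ)_1 ≤ ⋯ ≤ (D^{(r-1)}θ)_{n-r+1} ≤ a + V}`. -/
def CrMono (r n : ℕ) (a V : ℝ) : Set (Fin n → ℝ) :=
  {θ | a ≤ DD (r - 1) θ 0 ∧
    (∀ t : ℕ, t + 1 ≤ n - r → DD (r - 1) θ t ≤ DD (r - 1) θ (t + 1)) ∧
    DD (r - 1) θ (n - r) ≤ a + V}



section Poincare
variable {E : Type*} [NormedAddCommGroup E] [InnerProductSpace ℝ E] [FiniteDimensional ℝ E]
  [MeasurableSpace E] [BorelSpace E]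

lemma tf_cs_interval (g : ℝ → ℝ) (hg : Continuous g) (T : ℝ) (hT : 0 < T) :
    (∫ t in (0:ℝ)..T, g t) ^ 2 ≤ T * ∫ t in (0:ℝ)..T, g t ^ 2 := by
  set I := ∫ t in (0:ℝ)..T, g t with hI
  have h0 : 0 ≤ ∫ t in (0:ℝ)..T, (g t - I / T) ^ 2 :=
    intervalIntegral.integral_nonneg hT.le (fun t _ => sq_nonneg _)
  have h1 : ∫ t in (0:ℝ)..T, (g t - I / T) ^ 2 =
      (∫ t in (0:ℝ)..T, g t ^ 2) - 2 * (I / T) * I + T * (I / T) ^ 2 := by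
    have : ∀ t, (g t - I / T) ^ 2 = g t ^ 2 - 2 * (I / T) * g t + (I / T) ^ 2 := fun t => by ring
    simp_rw [this]
    rw [intervalIntegral.integral_add, intervalIntegral.integral_sub,
      intervalIntegral.integral_const_mul, intervalIntegral.integral_const]
    · simp [hI]
    all_goals exact Continuous.intervalIntegrable (by fun_prop) _ _
  rw [h1] at h0
  have h2 : T * ((∫ t in (0:ℝ)..T, g t ^ 2) - 2 * (I / T) * I + T * (I / T) ^ 2)
      = T * (∫ t in (0:ℝ)..T, g t ^ 2) - I ^ 2 := by
    field_simp; ring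
  nlinarith [mul_nonneg hT.le h0]

lemma tf_lintegral_dual (l : StrongDual ℝ E) :
    ∫⁻ y, ENNReal.ofReal ((l y) ^ 2) ∂(stdGaussian E) = ENNReal.ofReal (‖l‖ ^ 2) := by
  have hm : MemLp (fun y => l y) 2 (stdGaussian E) := IsGaussian.memLp_dual _ l 2 (by simp)
  rw [← variance_dual_stdGaussian, variance_eq_integral (by fun_prop),
    integral_strongDual_stdGaussian]
  simp only [sub_zero]
  rw [ofReal_integral_eq_lintegral_ofReal hm.integrable_sq (Filter.Eventually.of_forall fun _ => sq_nonneg _)]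

lemma tf_poincare_C1 (f : E → ℝ) (hf : ContDiff ℝ 1 f) (L : ℝ) 
    (hL : ∀ x, ‖fderiv ℝ f x‖ ≤ L) :
    ∫⁻ p, ENNReal.ofReal ((f p.2 - f p.1) ^ 2) ∂((stdGaussian E).prod (stdGaussian E)) ≤
      ENNReal.ofReal ((Real.pi / 2) ^ 2 * L ^ 2) := by
  set μ := stdGaussian E with hμ
  set G : E × E → ℝ := fun p => (fderiv ℝ f p.1 p.2) ^ 2 with hG
  have hfd : Continuous (fderiv ℝ f) := hf.continuous_fderiv (by norm_num)
  have hGc : Continuous G := by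
    have : Continuous (fun p : E × E => fderiv ℝ f p.1 p.2) :=
      (hfd.comp continuous_fst).clm_apply continuous_snd
    exact this.pow 2
  have hRc : Continuous (fun q : (E × E) × ℝ => (ContinuousLinearMap.rotation q.2 q.1 : E × E)) := by
    simp only [ContinuousLinearMap.rotation_apply]
    fun_prop
  have hpi : 0 < Real.pi / 2 := by positivity
  have hpt : ∀ p : E × E, ENNReal.ofReal ((f p.2 - f p.1) ^ 2) ≤
      ENNReal.ofReal (Real.pi / 2) * ∫⁻ t in Set.Ioc 0 (Real.pi / 2),
        ENNReal.ofReal (G (ContinuousLinearMap.rotation t p)) := by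
    intro p
    have hRp : Continuous (fun t : ℝ => (ContinuousLinearMap.rotation t p : E × E)) := by
      simp only [ContinuousLinearMap.rotation_apply]
      fun_prop
    have hd : ∀ t : ℝ, HasDerivAt (fun t => f (Real.cos t • p.1 + Real.sin t • p.2))
        (fderiv ℝ f (ContinuousLinearMap.rotation t p).1 (ContinuousLinearMap.rotation t p).2) t := by
      intro t
      have h1 : HasDerivAt (fun t : ℝ => Real.cos t • p.1 + Real.sin t • p.2)
          ((-Real.sin t) • p.1 + Real.cos t • p.2) t :=
        ((Real.hasDerivAt_cos t).smul_const p.1).add ((Real.hasDerivAt_sin t).smul_const p.2)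
      have h2 := (hf.differentiable (by norm_num)).differentiableAt
        (x := Real.cos t • p.1 + Real.sin t • p.2) |>.hasFDerivAt
      exact h2.comp_hasDerivAt t h1
    have hc : Continuous (fun t : ℝ => 
        (fderiv ℝ f (ContinuousLinearMap.rotation t p).1 (ContinuousLinearMap.rotation t p).2)) :=
      (hfd.comp (continuous_fst.comp hRp)).clm_apply (continuous_snd.comp hRp)
    have h3 := intervalIntegral.integral_eq_sub_of_hasDerivAt (a := 0) (b := Real.pi / 2)
      (fun t _ => hd t) (hc.intervalIntegrable _ _)
    simp only [Real.cos_pi_div_two, Real.sin_pi_div_two, Real.cos_zero, Real.sin_zero, zero_smul,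
      one_smul, zero_add, add_zero] at h3
    rw [← h3]
    refine (ENNReal.ofReal_le_ofReal (tf_cs_interval _ hc _ hpi)).trans ?_
    rw [ENNReal.ofReal_mul hpi.le, intervalIntegral.integral_of_le hpi.le,
      ofReal_integral_eq_lintegral_ofReal]
    · exact (hc.pow 2).integrableOn_Ioc
    · exact Filter.Eventually.of_forall fun _ => sq_nonneg _
  refine (lintegral_mono hpt).trans ?_
  rw [lintegral_const_mul' _ _ ENNReal.ofReal_ne_top, lintegral_lintegral_swap]
  swap
  · exact (ENNReal.continuous_ofReal.comp (hGc.comp hRc)).measurable.aemeasurable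
  have hin : ∀ t : ℝ, ∫⁻ p, ENNReal.ofReal (G (ContinuousLinearMap.rotation t p)) ∂(μ.prod μ) ≤
      ENNReal.ofReal (L ^ 2) := by
    intro t
    have hmeas : Measurable (fun p => ENNReal.ofReal (G p)) :=
      (ENNReal.continuous_ofReal.comp hGc).measurable
    have := IsGaussian.map_rotation_eq_self (μ := μ) (by simp [hμ]) t
    rw [← lintegral_map (f := fun p => ENNReal.ofReal (G p)) hmeas
      (ContinuousLinearMap.rotation t).continuous.measurable, this, lintegral_prod _ hmeas.aemeasurable]
    simp only [hG]
    calc ∫⁻ x, ∫⁻ y, ENNReal.ofReal ((fderiv ℝ f x y) ^ 2) ∂μ ∂μ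
        = ∫⁻ x, ENNReal.ofReal (‖fderiv ℝ f x‖ ^ 2) ∂μ := by
          simp_rw [hμ, tf_lintegral_dual]
      _ ≤ ∫⁻ x, ENNReal.ofReal (L ^ 2) ∂μ := by
          refine lintegral_mono fun x => ENNReal.ofReal_le_ofReal ?_
          exact pow_le_pow_left₀ (norm_nonneg _) (hL x) 2
      _ = _ := by simp
  calc _ ≤ ENNReal.ofReal (Real.pi / 2) * ∫⁻ t in Set.Ioc 0 (Real.pi / 2), ENNReal.ofReal (L ^ 2) := by
        gcongr with t
        exact hin t
    _ = _ := by
        rw [setLIntegral_const, Real.volume_Ioc, sub_zero, ← ENNReal.ofReal_mul (sq_nonneg _),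
          ← ENNReal.ofReal_mul hpi.le]
        congr 1; ring

lemma tf_poincare_lip (f : E → ℝ) (L : NNReal) (hf : LipschitzWith L f) :
    ∫⁻ p, ENNReal.ofReal ((f p.2 - f p.1) ^ 2) ∂((stdGaussian E).prod (stdGaussian E)) ≤
      ENNReal.ofReal (4 * (L : ℝ) ^ 2) := by
  let φ : ContDiffBump (0 : E) := ⟨1/20, 1/10, by norm_num, by norm_num⟩
  set g : E → ℝ := convolution (φ.normed volume) f (ContinuousLinearMap.lsmul ℝ ℝ) volume with hg
  have hgC : ContDiff ℝ 1 g :=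
    HasCompactSupport.contDiff_convolution_left _ φ.hasCompactSupport_normed
      φ.contDiff_normed hf.continuous.locallyIntegrable
  have hclose : ∀ x, dist (g x) (f x) ≤ L * (1/10) := by
    intro x
    refine φ.dist_normed_convolution_le hf.continuous.aestronglyMeasurable ?_
    intro y hy
    refine (hf.dist_le_mul y x).trans ?_
    have : dist y x < 1/10 := hy
    gcongr
  have hintg : ∀ x, Integrable (fun t => φ.normed volume t * f (x - t)) := by
    intro x
    exact (φ.continuous_normed.mul (by have := hf.continuous; fun_prop)).integrable_of_hasCompactSupport
      (φ.hasCompactSupport_normed.mul_right)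
  have hgL : LipschitzWith L g := by
    refine LipschitzWith.of_dist_le_mul fun x y => ?_
    have hgx : ∀ x, g x = ∫ t, φ.normed volume t * f (x - t) := by
      intro x; simp [hg, convolution_def]
    rw [dist_eq_norm, hgx, hgx, ← integral_sub (hintg x) (hintg y)]
    refine (norm_integral_le_of_norm_le (g := fun t => φ.normed volume t * (L * dist x y)) ?_ ?_).trans ?_
    · exact φ.integrable_normed.mul_const _
    · refine Filter.Eventually.of_forall fun t => ?_
      rw [← mul_sub, norm_mul, Real.norm_of_nonneg (φ.nonneg_normed t)]
      gcongr
      · exact φ.nonneg_normed t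
      have := hf.dist_le_mul (x - t) (y - t)
      rwa [dist_sub_right, dist_eq_norm] at this
    · rw [integral_mul_const, φ.integral_normed, one_mul]
  have h1 := tf_poincare_C1 g hgC L (fun x => norm_fderiv_le_of_lipschitz ℝ hgL)
  have hpt : ∀ p : E × E, (f p.2 - f p.1) ^ 2 ≤ 3 / 2 * (g p.2 - g p.1) ^ 2 + 3 * (L * (1/5)) ^ 2 := by
    intro p
    have a1 := abs_le.1 (hclose p.1)
    have a2 := abs_le.1 (hclose p.2)
    have hb : |(f p.2 - f p.1) - (g p.2 - g p.1)| ≤ L * (1/5) := by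
      rw [abs_le]; constructor <;> linarith [a1.1, a1.2, a2.1, a2.2]
    have hb2 : ((f p.2 - f p.1) - (g p.2 - g p.1)) ^ 2 ≤ (L * (1/5)) ^ 2 := sq_le_sq' (abs_le.1 hb).1 (abs_le.1 hb).2
    nlinarith [sq_nonneg ((g p.2 - g p.1) - 2 * ((f p.2 - f p.1) - (g p.2 - g p.1)))]
  calc _ ≤ ∫⁻ p, (ENNReal.ofReal (3 / 2) * ENNReal.ofReal ((g p.2 - g p.1) ^ 2) + ENNReal.ofReal (3 * (L * (1/5)) ^ 2))
        ∂((stdGaussian E).prod (stdGaussian E)) := by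
        refine lintegral_mono fun p => ?_
        rw [← ENNReal.ofReal_mul (by norm_num), ← ENNReal.ofReal_add (by positivity) (by positivity)]
        exact ENNReal.ofReal_le_ofReal (hpt p)
    _ ≤ ENNReal.ofReal (3 / 2) * ENNReal.ofReal ((Real.pi / 2) ^ 2 * L ^ 2) + ENNReal.ofReal (3 * (L * (1/5)) ^ 2) := by
        rw [lintegral_add_right _ measurable_const, lintegral_const_mul' _ _ ENNReal.ofReal_ne_top]
        gcongr
        simp
    _ ≤ _ := by
        rw [← ENNReal.ofReal_mul (by norm_num), ← ENNReal.ofReal_add (by positivity) (by positivity)]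
        apply ENNReal.ofReal_le_ofReal
        have : Real.pi ^ 2 ≤ 3.15 ^ 2 := by
          have := Real.pi_lt_d2
          have := Real.pi_pos
          gcongr
        nlinarith [sq_nonneg (L : ℝ)]

lemma tf_lip_memLp (f : E → ℝ) (L : NNReal) (hf : LipschitzWith L f) :
    MemLp f 2 (stdGaussian E) := by
  have h : MemLp (fun x : E => |f 0| + L * ‖x‖) 2 (stdGaussian E) :=
    by
    have h1 : MemLp (fun x : E => x) 2 (stdGaussian E) := IsGaussian.memLp_id _ 2 (by simp)
    have h2 : MemLp (fun x : E => ‖x‖) 2 (stdGaussian E) := h1.norm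
    have h3 : MemLp (fun x : E => (L : ℝ) * ‖x‖) 2 (stdGaussian E) := h2.const_mul _
    have h4 : MemLp (fun _ : E => |f 0|) 2 (stdGaussian E) := memLp_const _
    exact h4.add h3
  refine h.of_le hf.continuous.aestronglyMeasurable (Filter.Eventually.of_forall fun x => ?_)
  have h1 := hf.dist_le_mul x 0
  rw [dist_zero_right, Real.dist_eq] at h1
  rw [Real.norm_eq_abs, Real.norm_of_nonneg (by positivity)]
  have := abs_sub_abs_le_abs_sub (f x) (f 0)
  linarith

lemma tf_poincare (f : E → ℝ) (L : NNReal) (hf : LipschitzWith L f) :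
    ∫ x, (f x - ∫ y, f y ∂(stdGaussian E)) ^ 2 ∂(stdGaussian E) ≤ 2 * (L : ℝ) ^ 2 := by
  set μ := stdGaussian E with hμ
  have hm : MemLp f 2 μ := tf_lip_memLp f L hf
  have hi : Integrable f μ := hm.integrable (by norm_num)
  have hi2 : Integrable (fun x => f x ^ 2) μ := hm.integrable_sq
  set a := ∫ y, f y ∂μ
  have hip : Integrable (fun p : E × E => (f p.2 - f p.1) ^ 2) (μ.prod μ) := by
    have e : (fun p : E × E => (f p.2 - f p.1) ^ 2) = 
        fun p => f p.2 ^ 2 + f p.1 ^ 2 - 2 * (f p.1 * f p.2) := by ext p; ring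
    rw [e]
    exact ((hi2.comp_snd μ).add (hi2.comp_fst μ)).sub ((hi.mul_prod hi).const_mul 2)
  have h := tf_poincare_lip f L hf
  rw [← ofReal_integral_eq_lintegral_ofReal hip (Filter.Eventually.of_forall fun _ => sq_nonneg _),
    ENNReal.ofReal_le_ofReal_iff (by positivity), integral_prod _ hip] at h
  have h3 : ∀ c, ∫ y, (f y - c) ^ 2 ∂μ = (∫ y, f y ^ 2 ∂μ) - 2 * c * a + c ^ 2 := by
    intro c
    have e : ∀ y, (f y - c) ^ 2 = f y ^ 2 - 2 * c * f y + c ^ 2 := fun y => by ring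
    simp_rw [e]
    have i1 : Integrable (fun y => 2 * c * f y) μ := hi.const_mul _
    have i2 : Integrable (fun y => f y ^ 2 - 2 * c * f y) μ := hi2.sub i1
    rw [integral_add i2 (integrable_const _), integral_sub hi2 i1, integral_const_mul]
    simp [a]
  simp only [h3] at h
  have i1 : Integrable (fun x => 2 * f x * a) μ := (hi.const_mul 2).mul_const a
  have i2 : Integrable (fun x => (∫ y, f y ^ 2 ∂μ) - 2 * f x * a) μ := (integrable_const _).sub i1
  rw [integral_add i2 hi2, integral_sub (integrable_const _) i1, integral_mul_const,
    integral_const_mul] at h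
  simp only [integral_const, smul_eq_mul, probReal_univ, one_mul] at h
  rw [h3]
  change _ - 2 * a * a + _ ≤ _ at h
  nlinarith

end Poincare

lemma tf_gaussVec_one (n : ℕ) : (gaussVec n 1).map (WithLp.toLp 2) = stdGaussian (EuclideanSpace ℝ (Fin n)) := by
  rw [← map_pi_eq_stdGaussian]; simp [gaussVec]

instance tf_gaussVec_prob (n : ℕ) (σ : ℝ) : IsProbabilityMeasure (gaussVec n σ) := by
  unfold gaussVec; infer_instance

lemma tf_eunorm_eq {n : ℕ} (x : Fin n → ℝ) : eunorm x = ‖WithLp.toLp 2 x‖ := by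
  simp [eunorm, sqnorm, EuclideanSpace.norm_eq]

/-- Gaussian Poincare inequality for Lipschitz functions. -/
lemma tf_gauss_lip {n : ℕ} (g : (Fin n → ℝ) → ℝ) (L : ℝ) (hL : 0 ≤ L)
    (hg : ∀ z z', |g z - g z'| ≤ L * eunorm (z - z')) :
    Continuous g ∧ MemLp g 2 (gaussVec n 1) ∧
      ∫ z, (g z - ∫ y, g y ∂gaussVec n 1) ^ 2 ∂gaussVec n 1 ≤ 2 * L ^ 2 := by
  set f : EuclideanSpace ℝ (Fin n) → ℝ := fun x => g (WithLp.ofLp x) with hf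
  have hfl : LipschitzWith (L.toNNReal) f := by
    refine LipschitzWith.of_dist_le_mul fun x y => ?_
    have := hg (WithLp.ofLp x) (WithLp.ofLp y)
    rw [tf_eunorm_eq] at this
    rw [Real.dist_eq, dist_eq_norm, Real.coe_toNNReal L hL]
    exact this
  have hgf : g = f ∘ (WithLp.toLp 2) := by ext z; simp [hf]
  have hcont : Continuous (WithLp.toLp 2 : (Fin n → ℝ) → EuclideanSpace ℝ (Fin n)) := by fun_prop
  have hgc : Continuous g := by rw [hgf]; exact hfl.continuous.comp hcont
  have hmeas : AEMeasurable (WithLp.toLp 2 : (Fin n → ℝ) → EuclideanSpace ℝ (Fin n)) (gaussVec n 1) :=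
    hcont.measurable.aemeasurable
  have hm := tf_lip_memLp f _ hfl
  have hp := tf_poincare f _ hfl
  rw [← tf_gaussVec_one] at hm hp
  refine ⟨hgc, ?_, ?_⟩
  · rw [hgf]; exact hm.comp_of_map hmeas
  · have c1 : ∫ y, f y ∂(Measure.map (WithLp.toLp 2) (gaussVec n 1)) = ∫ y, g y ∂gaussVec n 1 := by
      rw [integral_map hmeas hfl.continuous.aestronglyMeasurable]
    have hc2 : Continuous (fun x => (f x - ∫ y, g y ∂gaussVec n 1) ^ 2) :=
      (hfl.continuous.sub continuous_const).pow 2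
    rw [c1, integral_map hmeas hc2.aestronglyMeasurable, Real.coe_toNNReal L hL] at hp
    exact hp



/-! ### Deterministic excursion construction -/

/-- Partial sums. -/
def wal (x : ℕ → ℝ) (t : ℕ) : ℝ := ∑ i ∈ Finset.range t, x i

/-- Running maximum of the partial sums. -/
def rmx (x : ℕ → ℝ) : ℕ → ℝ
  | 0 => 0
  | t + 1 => max (rmx x t) (wal x (t + 1))

/-- A convenient majorant of the running maximum of the absolute partial sums. -/
def bigM (x : ℕ → ℝ) (t : ℕ) : ℝ := rmx x t + rmx (fun i => - x i) t

lemma wal_neg (x : ℕ → ℝ) (t : ℕ) : wal (fun i => - x i) t = - wal x t := by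
  simp [wal]

lemma rmx_mono (x : ℕ → ℝ) : Monotone (rmx x) :=
  monotone_nat_of_le_succ fun t => le_max_left _ _

lemma rmx_nonneg (x : ℕ → ℝ) (t : ℕ) : 0 ≤ rmx x t := rmx_mono x (Nat.zero_le t)

lemma wal_le_rmx (x : ℕ → ℝ) (t : ℕ) : wal x t ≤ rmx x t := by
  cases t with
  | zero => simp [wal, rmx]
  | succ t => exact le_max_right _ _

lemma bigM_mono (x : ℕ → ℝ) : Monotone (bigM x) :=
  (rmx_mono x).add (rmx_mono _)

lemma bigM_nonneg (x : ℕ → ℝ) (t : ℕ) : 0 ≤ bigM x t :=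
  add_nonneg (rmx_nonneg _ _) (rmx_nonneg _ _)

lemma abs_wal_le (x : ℕ → ℝ) (t : ℕ) : |wal x t| ≤ bigM x t := by
  have h1 := wal_le_rmx x t
  have h2 := wal_le_rmx (fun i => - x i) t
  rw [wal_neg] at h2
  have h3 := rmx_nonneg x t
  have h4 := rmx_nonneg (fun i => - x i) t
  unfold bigM
  rw [abs_le]; constructor <;> linarith

lemma rmx_le_of (x : ℕ → ℝ) (t : ℕ) (c : ℝ) (hc : 0 ≤ c) (h : ∀ s ≤ t, wal x s ≤ c) : rmx x t ≤ c := by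
  induction t with
  | zero => simpa [rmx]
  | succ t ih => exact max_le (ih fun s hs => h s (by omega)) (h _ le_rfl)

/-- Pathwise Doob inequality. -/
lemma pathwise_doob (x : ℕ → ℝ) (t : ℕ) :
    rmx x t ^ 2 ≤ 4 * wal x t ^ 2 - 4 * ∑ i ∈ Finset.range t, rmx x i * x i := by
  have key : 2 * ∑ i ∈ Finset.range t, rmx x i * x i ≤ 2 * rmx x t * wal x t - rmx x t ^ 2 := by
    induction t with
    | zero => simp [rmx]
    | succ t ih =>
      rw [Finset.sum_range_succ]
      have hw : wal x (t + 1) = wal x t + x t := by simp [wal, Finset.sum_range_succ]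
      have hr : rmx x (t + 1) = max (rmx x t) (wal x (t + 1)) := rfl
      rcases le_total (rmx x t) (wal x (t+1)) with h | h
      · rw [hr, max_eq_right h]
        have hx : x t = wal x (t+1) - wal x t := by linarith
        rw [hx]
        nlinarith [sq_nonneg (rmx x t - wal x (t+1))]
      · rw [hr, max_eq_left h, hw]
        nlinarith
  nlinarith [sq_nonneg (rmx x t - 2 * wal x t)]

/-- The drift used to keep the excursion nonnegative. -/
def drf (x : ℕ → ℝ) (L t : ℕ) : ℝ := 2 * bigM x (min (2 * (t + 1)) L) / (t + 1)

lemma drf_nonneg (x : ℕ → ℝ) (L t : ℕ) : 0 ≤ drf x L t :=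
  div_nonneg (mul_nonneg (by norm_num) (bigM_nonneg _ _)) (by positivity)

lemma bigM_le_sum_drf (x : ℕ → ℝ) (L t : ℕ) (ht : t ≤ L) (hM0 : t = 0 → bigM x 0 = 0) :
    bigM x t ≤ ∑ s ∈ Finset.range t, drf x L s := by
  rcases Nat.eq_zero_or_pos t with rfl | hpos
  · simp [hM0 rfl]
  have h1 : ∑ s ∈ Finset.Ico (t / 2) t, (2 * bigM x t / t) ≤ ∑ s ∈ Finset.range t, drf x L s := by
    refine (Finset.sum_le_sum (g := fun s => drf x L s) ?_).trans
      (Finset.sum_le_sum_of_subset_of_nonneg ?_ fun s _ _ => drf_nonneg x L s)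
    · intro s hs
      rw [Finset.mem_Ico] at hs
      unfold drf
      have : bigM x t ≤ bigM x (min (2 * (s + 1)) L) := bigM_mono x (le_min (by omega) ht)
      have h2 : ((s : ℝ) + 1) ≤ t := by exact_mod_cast hs.2
      have := bigM_nonneg x (min (2 * (s + 1)) L)
      have h6 : (0:ℝ) ≤ 2 * bigM x (min (2 * (s + 1)) L) := by linarith
      gcongr
    · intro s hs; rw [Finset.mem_Ico] at hs; exact Finset.mem_range.2 hs.2
  refine le_trans ?_ h1
  rw [Finset.sum_const, Nat.card_Ico, nsmul_eq_mul]
  have h3 : (t : ℝ) / 2 ≤ ((t - t / 2 : ℕ) : ℝ) := by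
    rw [div_le_iff₀ (by norm_num)]; norm_cast; omega
  have h4 : 0 ≤ 2 * bigM x t / t := div_nonneg (mul_nonneg (by norm_num) (bigM_nonneg _ _)) (by positivity)
  have h5 : (0:ℝ) < t := by exact_mod_cast hpos
  calc bigM x t = t / 2 * (2 * bigM x t / t) := by field_simp
    _ ≤ _ := by gcongr

lemma bigM_zero (x : ℕ → ℝ) : bigM x 0 = 0 := by simp [bigM, rmx]

lemma excursion (x : ℕ → ℝ) (L : ℕ) :
    ∃ N : ℕ → ℝ, N 0 = 0 ∧ N L = 0 ∧ (∀ t ≤ L, 0 ≤ N t ∧ N t ≤ 2 * bigM x L) ∧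
      ∑ t ∈ Finset.range L, (x t - (N (t + 1) - N t)) ^ 2 ≤
        ∑ t ∈ Finset.range L, drf x L t ^ 2 +
          ∑ t ∈ Finset.range L, drf (fun i => x (L - 1 - i)) L t ^ 2 := by
  set y : ℕ → ℝ := fun i => x (L - 1 - i) with hy
  set A : ℕ → ℝ := fun t => - ∑ s ∈ Finset.range t, drf x L s with hA
  set B : ℕ → ℝ := fun t => wal x L - ∑ s ∈ Finset.range (L - t), drf y L s with hB
  set G : ℕ → ℝ := fun t => max (max (A t) (B t)) (- bigM x L) with hG
  have hrev : ∀ t ≤ L, wal y (L - t) = wal x L - wal x t := by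
    intro t ht
    have h1 : wal x L - wal x t = ∑ i ∈ Finset.Ico t L, x i := by
      rw [Finset.sum_Ico_eq_sub _ ht]; rfl
    rw [h1, wal, Finset.sum_Ico_eq_sum_range, ← Finset.sum_range_reflect]
    refine Finset.sum_congr rfl fun i hi => ?_
    rw [Finset.mem_range] at hi
    simp only [hy]
    congr 1; omega
  have hAS : ∀ t ≤ L, A t ≤ wal x t := by
    intro t ht
    have h1 := bigM_le_sum_drf x L t ht (fun _ => bigM_zero x)
    have h2 := abs_le.1 (abs_wal_le x t)
    simp only [hA]; linarith [h2.1]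
  have hBS : ∀ t ≤ L, B t ≤ wal x t := by
    intro t ht
    have h1 := bigM_le_sum_drf y L (L - t) (by omega) (fun _ => bigM_zero y)
    have h2 := abs_le.1 (abs_wal_le y (L - t))
    rw [hrev t ht] at h2
    simp only [hB]; linarith [h2.2]
  have hMS : ∀ t ≤ L, |wal x t| ≤ bigM x L := fun t ht => (abs_wal_le x t).trans (bigM_mono x ht)
  have hGS : ∀ t ≤ L, G t ≤ wal x t := fun t ht =>
    max_le (max_le (hAS t ht) (hBS t ht)) (abs_le.1 (hMS t ht)).1
  have hw0 : wal x 0 = 0 := by simp [wal]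
  refine ⟨fun t => wal x t - G t, ?_, ?_, ?_, ?_⟩
  · have h1 := hGS 0 (Nat.zero_le _)
    have h2 : A 0 ≤ G 0 := (le_max_left _ _).trans (le_max_left _ _)
    have h3 : A 0 = 0 := by simp [hA]
    simp only [hw0] at *
    linarith
  · have h1 := hGS L le_rfl
    have h2 : B L ≤ G L := (le_max_right _ _).trans (le_max_left _ _)
    have h3 : B L = wal x L := by simp [hB]
    simp only
    linarith
  · intro t ht
    have h1 := hGS t ht
    have h2 : - bigM x L ≤ G t := le_max_right _ _
    have h3 := (abs_le.1 (hMS t ht)).2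
    constructor <;> simp only <;> linarith
  · have hrefl : ∑ t ∈ Finset.range L, drf y L t ^ 2 = ∑ t ∈ Finset.range L, drf y L (L - 1 - t) ^ 2 :=
      (Finset.sum_range_reflect (fun t => drf y L t ^ 2) L).symm
    rw [hrefl, ← Finset.sum_add_distrib]
    refine Finset.sum_le_sum fun t ht => ?_
    rw [Finset.mem_range] at ht
    have e1 : x t - ((wal x (t + 1) - G (t + 1)) - (wal x t - G t)) = G (t + 1) - G t := by
      simp only [wal, Finset.sum_range_succ]; ring
    rw [e1]
    have hdA : |A (t + 1) - A t| = drf x L t := by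
      simp only [hA, Finset.sum_range_succ]
      rw [show -(∑ s ∈ Finset.range t, drf x L s + drf x L t) - -∑ s ∈ Finset.range t, drf x L s = - drf x L t by ring, abs_neg,
        abs_of_nonneg (drf_nonneg _ _ _)]
    have hdB : |B (t + 1) - B t| = drf y L (L - 1 - t) := by
      simp only [hB]
      rw [show L - t = (L - 1 - t) + 1 by omega, show L - (t + 1) = L - 1 - t by omega, Finset.sum_range_succ]
      rw [show ∀ a b c : ℝ, a - b - (a - (b + c)) = c by intros; ring, abs_of_nonneg (drf_nonneg _ _ _)]
    have h1 : |G (t + 1) - G t| ≤ max (drf x L t) (drf y L (L - 1 - t)) := by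
      refine (abs_max_sub_max_le_max _ _ _ _).trans (max_le ?_ ?_)
      · refine (abs_max_sub_max_le_max _ _ _ _).trans ?_
        rw [hdA, hdB]
      · simp only [sub_self, abs_zero]
        exact (drf_nonneg x L t).trans (le_max_left _ _)
    have h2 : (G (t + 1) - G t) ^ 2 ≤ max (drf x L t) (drf y L (L - 1 - t)) ^ 2 := by
      rw [← sq_abs]; exact pow_le_pow_left₀ (abs_nonneg _) h1 2
    refine h2.trans ?_
    rcases max_choice (drf x L t) (drf y L (L - 1 - t)) with h | h <;> rw [h]
    · linarith [sq_nonneg (drf y L (L - 1 - t))]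
    · linarith [sq_nonneg (drf x L t)]

/-! ### Gaussian moments -/

lemma gauss_linear_map {n : ℕ} (c : Fin n → ℝ) :
    (gaussVec n 1).map (fun z => ∑ i, c i * z i) = gaussianReal 0 (sqnorm c).toNNReal := by
  set l : StrongDual ℝ (EuclideanSpace ℝ (Fin n)) := innerSL ℝ (WithLp.toLp 2 c) with hl
  have h1 := IsGaussian.map_eq_gaussianReal (μ := stdGaussian (EuclideanSpace ℝ (Fin n))) l
  rw [variance_dual_stdGaussian, integral_strongDual_stdGaussian, ← tf_gaussVec_one,
    Measure.map_map l.continuous.measurable (by fun_prop)] at h1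
  have h2 : ‖l‖ ^ 2 = sqnorm c := by
    rw [hl, innerSL_apply_norm, EuclideanSpace.real_norm_sq_eq]; rfl
  rw [h2] at h1
  rw [← h1]
  congr 1
  ext z
  simp [hl, innerSL_apply_apply, PiLp.inner_apply, mul_comm]

lemma gauss_flip {n : ℕ} (j : Fin n) :
    MeasurePreserving (fun z : Fin n → ℝ => fun i => if i = j then - z i else z i) (gaussVec n 1) (gaussVec n 1) := by
  unfold gaussVec
  refine measurePreserving_pi (f := fun i x => if i = j then -x else x) _ _ (fun i => ?_)
  by_cases h : i = j
  · simp only [h, if_true]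
    exact ⟨measurable_neg, by rw [gaussianReal_map_neg, neg_zero]⟩
  · simp only [h, if_false]
    exact MeasurePreserving.id _

lemma gauss_odd_integral {n : ℕ} (j : Fin n) (F : (Fin n → ℝ) → ℝ) (hF : Continuous F)
    (h : ∀ z, F (fun i => if i = j then - z i else z i) = - F z) : ∫ z, F z ∂gaussVec n 1 = 0 := by
  have h1 : ∫ z, F z ∂gaussVec n 1 = ∫ z, F (fun i => if i = j then - z i else z i) ∂gaussVec n 1 := by
    conv_lhs => rw [← (gauss_flip j).map_eq]
    rw [integral_map (gauss_flip j).measurable.aemeasurable hF.aestronglyMeasurable]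
  simp_rw [h, integral_neg] at h1
  linarith

lemma pad_apply {n : ℕ} (z : Fin n → ℝ) (t : ℕ) (h : t < n) : pad z t = z ⟨t, h⟩ := by
  simp [pad, h]

lemma continuous_pad {n : ℕ} (t : ℕ) : Continuous (fun z : Fin n → ℝ => pad z t) := by
  by_cases h : t < n
  · simp only [pad, h, dif_pos]; fun_prop
  · simp only [pad, h, dif_neg, not_false_eq_true]; fun_prop

lemma continuous_lin {n : ℕ} (c : Fin n → ℝ) : Continuous (fun z : Fin n → ℝ => ∑ i, c i * z i) := by
  fun_prop

lemma linear_memLp {n : ℕ} (c : Fin n → ℝ) : MemLp (fun z => ∑ i, c i * z i) 2 (gaussVec n 1) := by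
  have : MemLp (fun x : ℝ => x) 2 ((gaussVec n 1).map (fun z => ∑ i, c i * z i)) := by
    rw [gauss_linear_map]; exact IsGaussian.memLp_id _ 2 (by simp)
  exact this.comp_of_map (continuous_lin c).measurable.aemeasurable

lemma linear_sq {n : ℕ} (c : Fin n → ℝ) : ∫ z, (∑ i, c i * z i) ^ 2 ∂gaussVec n 1 = sqnorm c := by
  have h0 : 0 ≤ sqnorm c := Finset.sum_nonneg fun i _ => sq_nonneg _
  have h : ∫ x, x ^ 2 ∂((gaussVec n 1).map (fun z => ∑ i, c i * z i)) = sqnorm c := by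
    rw [gauss_linear_map]
    have := variance_id_gaussianReal (μ := 0) (v := (sqnorm c).toNNReal)
    rw [variance_eq_integral (by fun_prop)] at this
    simpa [h0] using this
  rw [← h, integral_map (continuous_lin c).measurable.aemeasurable (by fun_prop)]

lemma linear_tail {n : ℕ} (c : Fin n → ℝ) (V a : ℝ) (hV : 0 < V) (hc : sqnorm c ≤ V) (ha : 0 ≤ a) :
    (gaussVec n 1).real {z | a ≤ ∑ i, c i * z i} ≤ Real.exp (- a ^ 2 / (2 * V)) := by
  have h0 : 0 ≤ sqnorm c := Finset.sum_nonneg fun i _ => sq_nonneg _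
  have hmap := gauss_linear_map c
  have hi : Integrable (fun z => Real.exp (a / V * ∑ i, c i * z i)) (gaussVec n 1) := by
    have : Integrable (fun x => Real.exp (a / V * x)) ((gaussVec n 1).map (fun z => ∑ i, c i * z i)) := by
      rw [hmap]; exact integrable_exp_mul_gaussianReal _
    exact this.comp_measurable (by fun_prop)
  have h1 := measure_ge_le_exp_mul_mgf (X := fun z : Fin n → ℝ => ∑ i, c i * z i) (μ := gaussVec n 1) 
    (t := a / V) a (by positivity) hi
  refine h1.trans ?_
  rw [mgf_gaussianReal hmap, ← Real.exp_add, Real.exp_le_exp]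
  simp only [Real.coe_toNNReal _ h0, zero_mul, zero_add]
  calc -(a / V) * a + sqnorm c * (a / V) ^ 2 / 2 ≤ -(a / V) * a + V * (a / V) ^ 2 / 2 := by gcongr
    _ = _ := by field_simp; ring

lemma pad_eq_linear {n : ℕ} (t : ℕ) : ∃ c : Fin n → ℝ, sqnorm c ≤ 1 ∧ (t < n → sqnorm c = 1) ∧ ∀ z, pad z t = ∑ i, c i * z i := by
  by_cases h : t < n
  · refine ⟨fun i => if i = ⟨t, h⟩ then 1 else 0, ?_, ?_, fun z => ?_⟩
    · simp [sqnorm]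
    · simp [sqnorm]
    · simp [pad, h]
  · refine ⟨0, by simp [sqnorm], fun h' => absurd h' h, fun z => by simp [pad, h]⟩

lemma pad_memLp {n : ℕ} (t : ℕ) : MemLp (fun z : Fin n → ℝ => pad z t) 2 (gaussVec n 1) := by
  obtain ⟨c, -, -, h⟩ := pad_eq_linear (n := n) t
  simp_rw [h]; exact linear_memLp c

lemma pad_four {n : ℕ} (t : ℕ) : Integrable (fun z : Fin n → ℝ => pad z t ^ 4) (gaussVec n 1) ∧
    ∫ z, pad z t ^ 4 ∂gaussVec n 1 ≤ 96 := by
  obtain ⟨c, hc, -, h⟩ := pad_eq_linear (n := n) t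
  have h0 : 0 ≤ sqnorm c := Finset.sum_nonneg fun i _ => sq_nonneg _
  have hmap := gauss_linear_map c
  simp_rw [← h] at hmap
  have hi : ∀ s : ℝ, Integrable (fun z : Fin n → ℝ => Real.exp (s * pad z t)) (gaussVec n 1) := by
    intro s
    have : Integrable (fun x => Real.exp (s * x)) ((gaussVec n 1).map (fun z => pad z t)) := by
      rw [hmap]; exact integrable_exp_mul_gaussianReal _
    exact this.comp_measurable (continuous_pad t).measurable
  have hm : ∀ s : ℝ, s ^ 2 = 1 → ∫ z : Fin n → ℝ, Real.exp (s * pad z t) ∂gaussVec n 1 ≤ 2 := by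
    intro s hs
    have h2 : mgf (fun z : Fin n → ℝ => pad z t) (gaussVec n 1) s = _ := mgf_gaussianReal hmap s
    rw [mgf] at h2
    rw [h2, hs, Real.coe_toNNReal _ h0]
    have : Real.exp (0 * s + sqnorm c * 1 / 2) ≤ Real.exp (1/2) := Real.exp_le_exp.2 (by linarith)
    refine this.trans ?_
    have e1 := Real.exp_one_lt_d9
    have e2 : Real.exp (1/2) * Real.exp (1/2) = Real.exp 1 := by rw [← Real.exp_add]; norm_num
    nlinarith [Real.exp_pos (1/2)]
  have hpt : ∀ z : Fin n → ℝ, pad z t ^ 4 ≤ 24 * (Real.exp (1 * pad z t) + Real.exp (-1 * pad z t)) := by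
    intro z
    have h1 := Real.pow_div_factorial_le_exp |pad z t| (abs_nonneg _) 4
    have h2 : |pad z t| ^ 4 = pad z t ^ 4 := by
      rw [show (4:ℕ) = 2 * 2 by norm_num, pow_mul, pow_mul, sq_abs]
    have h3 : Real.exp |pad z t| ≤ Real.exp (1 * pad z t) + Real.exp (-1 * pad z t) := by
      rcases abs_choice (pad z t) with h | h <;> rw [h] <;> simp [Real.exp_nonneg]
    rw [h2] at h1
    have : ((Nat.factorial 4 : ℕ) : ℝ) = 24 := by norm_num [Nat.factorial]
    rw [this] at h1
    linarith
  have hintg : Integrable (fun z : Fin n → ℝ => 24 * (Real.exp (1 * pad z t) + Real.exp (-1 * pad z t))) (gaussVec n 1) :=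
    ((hi 1).add (hi (-1))).const_mul 24
  constructor
  · refine hintg.mono' ((continuous_pad t).pow 4).aestronglyMeasurable (Filter.Eventually.of_forall fun z => ?_)
    rw [Real.norm_of_nonneg (by positivity)]
    exact hpt z
  · refine (integral_mono_of_nonneg (Filter.Eventually.of_forall fun z => by simp only [Pi.zero_apply]; positivity) hintg 
      (Filter.Eventually.of_forall hpt)).trans ?_
    rw [integral_const_mul, integral_add (hi 1) (hi (-1))]
    linarith [hm 1 (by norm_num), hm (-1) (by norm_num)]



lemma wal_congr {x y : ℕ → ℝ} {t : ℕ} (h : ∀ i < t, x i = y i) : wal x t = wal y t :=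
  Finset.sum_congr rfl fun i hi => h i (Finset.mem_range.1 hi)

lemma rmx_congr {x y : ℕ → ℝ} {t : ℕ} (h : ∀ i < t, x i = y i) : rmx x t = rmx y t := by
  induction t with
  | zero => rfl
  | succ t ih =>
    simp only [rmx]
    rw [ih fun i hi => h i (by omega), wal_congr h]

/-- The coordinates of a Gaussian vector read along `g`, with sign `τ`. -/
def ycoord {n : ℕ} (τ : ℝ) (g : ℕ → ℕ) (z : Fin n → ℝ) : ℕ → ℝ := fun i => τ * pad z (g i)

lemma wal_linear {n : ℕ} (τ : ℝ) (hτ : τ ^ 2 = 1) (g : ℕ → ℕ) (L : ℕ) (hg : Set.InjOn g (Set.Iio L))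
    (t : ℕ) (ht : t ≤ L) : ∃ c : Fin n → ℝ, sqnorm c ≤ t ∧ ∀ z, wal (ycoord τ g z) t = ∑ i, c i * z i := by
  refine ⟨fun i => τ * ((Finset.range t).filter fun s => g s = i).card, ?_, fun z => ?_⟩
  · unfold sqnorm
    have h1 : ∀ i : Fin n, (τ * (((Finset.range t).filter fun s => g s = i).card : ℝ)) ^ 2 =
        (((Finset.range t).filter fun s => g s = i).card : ℝ) := by
      intro i
      rw [mul_pow, hτ, one_mul]
      have : ((Finset.range t).filter fun s => g s = i).card ≤ 1 := by
        rw [Finset.card_le_one]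
        intro a ha b hb
        simp only [Finset.mem_filter, Finset.mem_range] at ha hb
        exact hg (by simp; omega) (by simp; omega) (ha.2.trans hb.2.symm)
      interval_cases h : ((Finset.range t).filter fun s => g s = i).card <;> simp
    simp_rw [h1]
    have h2 : ∀ i : Fin n, (((Finset.range t).filter fun s => g s = i).card : ℝ) =
        ∑ s ∈ Finset.range t, if g s = i then (1:ℝ) else 0 := by
      intro i; simp
    simp_rw [h2]
    rw [Finset.sum_comm]
    have : ∀ s ∈ Finset.range t, ∑ i : Fin n, (if g s = (i:ℕ) then (1:ℝ) else 0) ≤ 1 := by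
      intro s _
      by_cases hs : g s < n
      · rw [Finset.sum_eq_single ⟨g s, hs⟩]
        · simp
        · intro b _ hb; rw [if_neg]; intro h; apply hb; ext; simp [h]
        · simp
      · rw [Finset.sum_eq_zero]
        · norm_num
        · intro i _; rw [if_neg]; have := i.2; omega
    refine (Finset.sum_le_sum this).trans ?_
    simp
  · have h2 : ∀ i : Fin n, (((Finset.range t).filter fun s => g s = i).card : ℝ) =
        ∑ s ∈ Finset.range t, if g s = i then (1:ℝ) else 0 := by
      intro i; simp
    simp_rw [h2, mul_assoc, Finset.sum_mul, Finset.mul_sum]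
    rw [Finset.sum_comm]
    refine Finset.sum_congr rfl fun s _ => ?_
    unfold ycoord
    by_cases hs : g s < n
    · rw [pad_apply _ _ hs, Finset.sum_eq_single ⟨g s, hs⟩]
      · simp
      · intro b _ hb; rw [if_neg]; · simp
        intro h; apply hb; ext; simp [h]
      · simp
    · rw [Finset.sum_eq_zero]
      · simp [pad, hs]
      · intro i _; rw [if_neg]; · simp
        have := i.2; omega

lemma wal_cont {n : ℕ} (τ : ℝ) (g : ℕ → ℕ) (t : ℕ) : Continuous fun z : Fin n → ℝ => wal (ycoord τ g z) t := by
  unfold wal ycoord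
  exact continuous_finsetSum _ fun i _ => continuous_const.mul (continuous_pad _)

lemma wal_memLp {n : ℕ} (τ : ℝ) (g : ℕ → ℕ) (t : ℕ) :
    MemLp (fun z : Fin n → ℝ => wal (ycoord τ g z) t) 2 (gaussVec n 1) := by
  unfold wal ycoord
  exact memLp_finsetSum _ fun i _ => (pad_memLp _).const_mul _

lemma rmx_cont {n : ℕ} (τ : ℝ) (g : ℕ → ℕ) (t : ℕ) : Continuous fun z : Fin n → ℝ => rmx (ycoord τ g z) t := by
  induction t with
  | zero => exact continuous_const
  | succ t ih => exact ih.max (wal_cont τ g (t+1))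

lemma rmx_memLp {n : ℕ} (τ : ℝ) (g : ℕ → ℕ) (t : ℕ) :
    MemLp (fun z : Fin n → ℝ => rmx (ycoord τ g z) t) 2 (gaussVec n 1) := by
  induction t with
  | zero => exact memLp_const 0
  | succ t ih => exact MemLp.sup ih (wal_memLp τ g (t+1))

lemma rmx_sq {n : ℕ} (τ : ℝ) (hτ : τ ^ 2 = 1) (g : ℕ → ℕ) (L : ℕ) (hg : Set.InjOn g (Set.Iio L))
    (hgn : ∀ i < L, g i < n) (t : ℕ) (ht : t ≤ L) :
    ∫ z, rmx (ycoord τ g z) t ^ 2 ∂gaussVec n 1 ≤ 4 * t := by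
  have hintg : ∀ i, Integrable (fun z : Fin n → ℝ => rmx (ycoord τ g z) i * ycoord τ g z i) (gaussVec n 1) := by
    intro i
    exact (rmx_memLp τ g i).integrable_mul ((pad_memLp (g i)).const_mul τ)
  have h0 : ∀ i ∈ Finset.range t, ∫ z : Fin n → ℝ, rmx (ycoord τ g z) i * ycoord τ g z i ∂(gaussVec n 1) = 0 := by
    intro i hi
    rw [Finset.mem_range] at hi
    have hgi := hgn i (by omega)
    refine gauss_odd_integral ⟨g i, hgi⟩ _ ((rmx_cont τ g i).mul (continuous_const.mul (continuous_pad _))) ?_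
    intro z
    have e1 : rmx (ycoord τ g fun m => if m = ⟨g i, hgi⟩ then - z m else z m) i = rmx (ycoord τ g z) i := by
      apply rmx_congr
      intro s hs
      unfold ycoord
      rw [pad_apply _ _ (hgn s (by omega)), pad_apply _ _ (hgn s (by omega)), if_neg]
      intro h
      rw [Fin.mk.injEq] at h
      have := hg (by simp; omega) (by simp; omega) h
      omega
    rw [e1]
    simp only [ycoord, pad_apply _ _ hgi, if_true]
    ring
  obtain ⟨c, hc, hcw⟩ := wal_linear (n := n) τ hτ g L hg t ht
  have hw : ∫ z, wal (ycoord τ g z) t ^ 2 ∂gaussVec n 1 ≤ t := by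
    simp_rw [hcw]; rw [linear_sq]; exact hc
  have hwi : Integrable (fun z : Fin n → ℝ => 4 * wal (ycoord τ g z) t ^ 2) (gaussVec n 1) := (wal_memLp τ g t).integrable_sq.const_mul 4
  have hsi : Integrable (fun z : Fin n → ℝ => 4 * ∑ i ∈ Finset.range t, rmx (ycoord τ g z) i * ycoord τ g z i) (gaussVec n 1) :=
    (integrable_finsetSum _ fun i _ => hintg i).const_mul 4
  refine (integral_mono (rmx_memLp τ g t).integrable_sq (hwi.sub hsi) fun z => pathwise_doob _ t).trans ?_
  simp only [Pi.sub_apply]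
  rw [integral_sub hwi hsi, integral_const_mul, integral_const_mul, integral_finsetSum _ fun i _ => hintg i,
    Finset.sum_eq_zero h0]
  linarith

lemma bigM_cont {n : ℕ} (τ : ℝ) (g : ℕ → ℕ) (t : ℕ) : Continuous fun z : Fin n → ℝ => bigM (ycoord τ g z) t := by
  have e : ∀ z : Fin n → ℝ, (fun i => - ycoord τ g z i) = ycoord (-τ) g z := by
    intro z; ext i; simp [ycoord]
  simp only [bigM, e]
  exact (rmx_cont τ g t).add (rmx_cont (-τ) g t)

lemma bigM_sq {n : ℕ} (τ : ℝ) (hτ : τ ^ 2 = 1) (g : ℕ → ℕ) (L : ℕ) (hg : Set.InjOn g (Set.Iio L))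
    (hgn : ∀ i < L, g i < n) (t : ℕ) (ht : t ≤ L) :
    Integrable (fun z : Fin n → ℝ => bigM (ycoord τ g z) t ^ 2) (gaussVec n 1) ∧
    ∫ z, bigM (ycoord τ g z) t ^ 2 ∂gaussVec n 1 ≤ 16 * t := by
  have e : ∀ z : Fin n → ℝ, (fun i => - ycoord τ g z i) = ycoord (-τ) g z := by
    intro z; ext i; simp [ycoord]
  have hm := ((rmx_memLp τ g t).add (rmx_memLp (n := n) (-τ) g t)).integrable_sq
  simp only [bigM, e]
  refine ⟨hm, ?_⟩
  have h1 := rmx_sq (n := n) τ hτ g L hg hgn t ht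
  have h2 := rmx_sq (n := n) (-τ) (by rw [neg_sq, hτ]) g L hg hgn t ht
  have i1 := (rmx_memLp (n := n) τ g t).integrable_sq
  have i2 := (rmx_memLp (n := n) (-τ) g t).integrable_sq
  refine (integral_mono (g := fun z : Fin n → ℝ => 2 * (rmx (ycoord τ g z) t ^ 2 + rmx (ycoord (-τ) g z) t ^ 2)) hm 
    ((i1.add i2).const_mul 2) fun z => ?_).trans ?_
  · simp only [Pi.add_apply]
    nlinarith [sq_nonneg (rmx (ycoord τ g z) t - rmx (ycoord (-τ) g z) t)]
  · rw [integral_const_mul, integral_add i1 i2]; linarith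

lemma drf_sum {n : ℕ} (τ : ℝ) (hτ : τ ^ 2 = 1) (g : ℕ → ℕ) (L : ℕ) (hg : Set.InjOn g (Set.Iio L))
    (hgn : ∀ i < L, g i < n) :
    Integrable (fun z : Fin n → ℝ => ∑ t ∈ Finset.range L, drf (ycoord τ g z) L t ^ 2) (gaussVec n 1) ∧
    ∫ z, ∑ t ∈ Finset.range L, drf (ycoord τ g z) L t ^ 2 ∂gaussVec n 1 ≤ 128 * (1 + Real.log L) := by
  have e : ∀ t (z : Fin n → ℝ), drf (ycoord τ g z) L t ^ 2 = 4 / ((t : ℝ) + 1) ^ 2 * bigM (ycoord τ g z) (min (2 * (t + 1)) L) ^ 2 := by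
    intro t z; unfold drf; field_simp; ring
  simp only [e]
  have hb := fun t => bigM_sq (n := n) τ hτ g L hg hgn (min (2 * (t + 1)) L) (min_le_right _ _)
  have hi : ∀ t ∈ Finset.range L, Integrable (fun z : Fin n → ℝ => 4 / ((t : ℝ) + 1) ^ 2 * bigM (ycoord τ g z) (min (2 * (t + 1)) L) ^ 2) (gaussVec n 1) :=
    fun t _ => (hb t).1.const_mul _
  refine ⟨integrable_finsetSum _ hi, ?_⟩
  rw [integral_finsetSum _ hi]
  have h1 : ∀ t ∈ Finset.range L, ∫ z : Fin n → ℝ, 4 / ((t : ℝ) + 1) ^ 2 * bigM (ycoord τ g z) (min (2 * (t + 1)) L) ^ 2 ∂(gaussVec n 1)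
      ≤ 128 * ((t : ℝ) + 1)⁻¹ := by
    intro t _
    rw [integral_const_mul]
    have h2 := (hb t).2
    have h3 : ((min (2 * (t + 1)) L : ℕ) : ℝ) ≤ 2 * (t + 1) := by
      have : min (2 * (t + 1)) L ≤ 2 * (t + 1) := min_le_left _ _
      exact_mod_cast this
    calc _ ≤ 4 / ((t : ℝ) + 1) ^ 2 * (16 * (2 * (t + 1))) := by
          gcongr; linarith
      _ = _ := by field_simp; norm_num
  refine (Finset.sum_le_sum h1).trans ?_
  rw [← Finset.mul_sum]
  have h4 := harmonic_le_one_add_log L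
  have h5 : ((harmonic L : ℚ) : ℝ) = ∑ t ∈ Finset.range L, ((t:ℝ) + 1)⁻¹ := by
    simp [harmonic]
  rw [h5] at h4
  linarith

lemma bigM_tail {n : ℕ} (τ : ℝ) (hτ : τ ^ 2 = 1) (g : ℕ → ℕ) (L : ℕ) (hg : Set.InjOn g (Set.Iio L))
    (M : ℝ) (hM : 0 < M) (hLM : (L : ℝ) ≤ M) (a : ℝ) (ha : 0 ≤ a) :
    (gaussVec n 1).real {z | 2 * a < bigM (ycoord τ g z) L} ≤ 2 * (M + 1) * Real.exp (- a ^ 2 / (2 * M)) := by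
  have e : ∀ z : Fin n → ℝ, (fun i => - ycoord τ g z i) = ycoord (-τ) g z := by
    intro z; ext i; simp [ycoord]
  have hP : ∀ τ : ℝ, τ ^ 2 = 1 → ∀ t ∈ Finset.range (L + 1), (gaussVec n 1).real {z | a ≤ wal (ycoord τ g z) t} ≤ Real.exp (- a ^ 2 / (2 * M)) := by
    intro τ hτ t ht
    rw [Finset.mem_range] at ht
    obtain ⟨c, hc, hcw⟩ := wal_linear (n := n) τ hτ g L hg t (by omega)
    simp_rw [hcw]
    have : (t : ℝ) ≤ L := by exact_mod_cast (by omega : t ≤ L)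
    exact linear_tail c M a hM (by linarith) ha
  have hsub : {z : Fin n → ℝ | 2 * a < bigM (ycoord τ g z) L} ⊆
      (⋃ t ∈ Finset.range (L + 1), {z | a ≤ wal (ycoord τ g z) t}) ∪ (⋃ t ∈ Finset.range (L + 1), {z | a ≤ wal (ycoord (-τ) g z) t}) := by
    intro z hz
    by_contra hcon
    simp only [Set.mem_union, Set.mem_iUnion, Set.mem_ofPred_eq, Finset.mem_range, not_or, not_exists, not_le] at hcon
    have h1 := rmx_le_of (ycoord τ g z) L a ha fun s hs => (hcon.1 s (by omega)).le
    have h2 := rmx_le_of (ycoord (-τ) g z) L a ha fun s hs => (hcon.2 s (by omega)).le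
    simp only [Set.mem_ofPred_eq, bigM, e] at hz
    linarith
  refine (measureReal_mono hsub).trans ((measureReal_union_le _ _).trans ?_)
  have hs : ∀ τ : ℝ, τ ^ 2 = 1 → (gaussVec n 1).real (⋃ t ∈ Finset.range (L + 1), {z | a ≤ wal (ycoord τ g z) t}) ≤ (M + 1) * Real.exp (- a ^ 2 / (2 * M)) := by
    intro τ hτ
    refine (measureReal_biUnion_finset_le _ _).trans ((Finset.sum_le_sum (hP τ hτ)).trans ?_)
    rw [Finset.sum_const, Finset.card_range, nsmul_eq_mul]
    push_cast
    gcongr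
  linarith [hs τ hτ, hs (-τ) (by rw [neg_sq, hτ])]



lemma piece {n : ℕ} (M : ℕ) (hM : 1 ≤ M) (lam0 : ℝ) (hl0 : 0 ≤ lam0) (hl : lam0 ^ 2 = 96 * M * (1 + Real.log M))
    (a b : ℕ) (hab : a ≤ b) (hbn : b ≤ n) (hbM : b - a ≤ M) (s : ℝ) (hs : s ^ 2 = 1) :
    ∃ c : (Fin n → ℝ) → ℝ, Integrable c (gaussVec n 1) ∧ ∫ z, c z ∂gaussVec n 1 ≤ 400 * (1 + Real.log M) ∧
      ∀ z, ∃ N : ℕ → ℝ, N a = 0 ∧ N b = 0 ∧ (∀ t, a ≤ t → t ≤ b → 0 ≤ s * N t ∧ s * N t ≤ lam0) ∧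
        ∑ t ∈ Finset.Ico a b, (pad z t + (N (t + 1) - N t)) ^ 2 ≤ c z := by
  set L := b - a with hL
  have hMr : (1:ℝ) ≤ M := by exact_mod_cast hM
  have hMpos : (0:ℝ) < M := by linarith
  have hlog : 0 ≤ Real.log M := Real.log_nonneg hMr
  have hLM : (L : ℝ) ≤ M := by exact_mod_cast hbM
  set g1 : ℕ → ℕ := fun i => a + i with hg1
  set g2 : ℕ → ℕ := fun i => a + (L - 1 - i) with hg2
  have hs' : (-s) ^ 2 = 1 := by rw [neg_sq, hs]
  have inj1 : Set.InjOn g1 (Set.Iio L) := by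
    intro i hi j hj h; simp only [hg1] at h; omega
  have inj2 : Set.InjOn g2 (Set.Iio L) := by
    intro i hi j hj h; simp only [hg2, Set.mem_Iio] at h hi hj; omega
  have lt1 : ∀ i < L, g1 i < n := by intro i hi; simp only [hg1]; omega
  have lt2 : ∀ i < L, g2 i < n := by intro i hi; simp only [hg2]; omega
  obtain ⟨i1, b1⟩ := drf_sum (n := n) (-s) hs' g1 L inj1 lt1
  obtain ⟨i2, b2⟩ := drf_sum (n := n) (-s) hs' g2 L inj2 lt2
  have htail := bigM_tail (n := n) (-s) hs' g1 L inj1 M hMpos hLM (lam0 / 4) (by positivity)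
  set F : Set (Fin n → ℝ) := {z | 2 * (lam0 / 4) < bigM (ycoord (-s) g1 z) L} with hF
  have hFm : MeasurableSet F := (isOpen_lt continuous_const (bigM_cont _ _ _)).measurableSet
  have hPF : (gaussVec n 1).real F ≤ 1 / (M:ℝ) ^ 2 := by
    refine htail.trans ?_
    have e1 : -(lam0 / 4) ^ 2 / (2 * (M:ℝ)) = - 3 + (-(3 * Real.log M)) := by
      rw [div_pow, hl]; field_simp; ring
    have e2 : Real.exp (-(3 * Real.log M)) = 1 / (M:ℝ) ^ 3 := by
      rw [Real.exp_neg, mul_comm, Real.exp_mul, Real.exp_log hMpos, one_div]; norm_cast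
    have e3 : Real.exp (-3) ≤ 1 / 4 := by
      rw [Real.exp_neg, ← one_div]
      apply one_div_le_one_div_of_le (by norm_num)
      linarith [Real.add_one_le_exp 3]
    rw [e1, Real.exp_add, e2]
    calc 2 * ((M:ℝ) + 1) * (Real.exp (-3) * (1 / M ^ 3)) ≤ 2 * ((M:ℝ) + M) * (1 / 4 * (1 / M ^ 3)) := by gcongr
      _ = 1 / (M:ℝ) ^ 2 := by field_simp; ring
  set q : (Fin n → ℝ) → ℝ := fun z => ∑ t ∈ Finset.Ico a b, pad z t ^ 4 * (1 / (2 * M)) with hq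
  have iq : Integrable q (gaussVec n 1) := integrable_finsetSum _ fun t _ => (pad_four t).1.mul_const _
  have bq : ∫ z, q z ∂gaussVec n 1 ≤ 48 := by
    rw [hq, integral_finsetSum _ fun t _ => (pad_four t).1.mul_const _]
    have : ∀ t ∈ Finset.Ico a b, ∫ z : Fin n → ℝ, pad z t ^ 4 * (1 / (2 * (M:ℝ))) ∂gaussVec n 1 ≤ 48 / (M:ℝ) := by
      intro t _
      rw [integral_mul_const]
      calc _ ≤ 96 * (1 / (2 * (M:ℝ))) := by gcongr; exact (pad_four t).2
        _ = _ := by field_simp; norm_num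
    refine (Finset.sum_le_sum this).trans ?_
    rw [Finset.sum_const, Nat.card_Ico, nsmul_eq_mul]
    calc ((b - a : ℕ) : ℝ) * (48 / M) ≤ M * (48 / M) := by gcongr
      _ = 48 := by field_simp
  set d : (Fin n → ℝ) → ℝ := F.indicator fun _ => (M:ℝ) ^ 2 / 2 with hd
  have idd : Integrable d (gaussVec n 1) := (integrable_const _).indicator hFm
  have bd : ∫ z, d z ∂gaussVec n 1 ≤ 1 := by
    rw [hd, integral_indicator_const _ hFm, smul_eq_mul]
    calc _ ≤ 1 / (M:ℝ) ^ 2 * ((M:ℝ) ^ 2 / 2) := by gcongr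
      _ = 1 / 2 := by field_simp
      _ ≤ 1 := by norm_num
  have hlogL : Real.log L ≤ Real.log M := by
    rcases Nat.eq_zero_or_pos L with h | h
    · rw [h]; simpa using hlog
    · exact Real.log_le_log (by exact_mod_cast h) hLM
  refine ⟨fun z => (∑ t ∈ Finset.range L, drf (ycoord (-s) g1 z) L t ^ 2 + ∑ t ∈ Finset.range L, drf (ycoord (-s) g2 z) L t ^ 2) + (q z + d z),
    (i1.add i2).add (iq.add idd), ?_, fun z => ?_⟩
  · have e1 := integral_add (i1.add i2) (iq.add idd)
    have e2 := integral_add i1 i2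
    have e3 := integral_add iq idd
    simp only [Pi.add_apply] at e1 e2 e3
    rw [e1, e2, e3]
    linarith
  have hq0 : 0 ≤ q z := Finset.sum_nonneg fun t _ => by positivity
  have hd0 : 0 ≤ d z := Set.indicator_nonneg (fun _ _ => by positivity) z
  have hr0 : 0 ≤ ∑ t ∈ Finset.range L, drf (ycoord (-s) g1 z) L t ^ 2 + ∑ t ∈ Finset.range L, drf (ycoord (-s) g2 z) L t ^ 2 := by positivity
  by_cases hz : z ∈ F
  · refine ⟨fun _ => 0, rfl, rfl, fun t _ _ => by simp [hl0], ?_⟩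
    have h1 : d z = (M:ℝ) ^ 2 / 2 := by rw [hd, Set.indicator_of_mem hz]
    have h2 : ∑ t ∈ Finset.Ico a b, (pad z t + (0 - 0)) ^ 2 ≤ ∑ t ∈ Finset.Ico a b, (pad z t ^ 4 * (1 / (2 * M)) + (M:ℝ) / 2) := by
      refine Finset.sum_le_sum fun t _ => ?_
      have h3 : pad z t ^ 4 * (1 / (2 * M)) + (M:ℝ) / 2 - (pad z t + (0 - 0)) ^ 2 = (pad z t ^ 2 - M) ^ 2 / (2 * M) := by
        field_simp; ring
      have : 0 ≤ (pad z t ^ 2 - M) ^ 2 / (2 * (M:ℝ)) := by positivity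
      linarith
    rw [Finset.sum_add_distrib, Finset.sum_const, Nat.card_Ico, nsmul_eq_mul] at h2
    have h4 : ((b - a : ℕ) : ℝ) * ((M:ℝ) / 2) ≤ M * ((M:ℝ) / 2) := by gcongr
    simp only at h2 ⊢
    rw [h1]
    have : q z = ∑ t ∈ Finset.Ico a b, pad z t ^ 4 * (1 / (2 * (M:ℝ))) := rfl
    linarith
  · obtain ⟨N, N0, NL, Nb, Nc⟩ := excursion (ycoord (-s) g1 z) L
    have hF' : bigM (ycoord (-s) g1 z) L ≤ 2 * (lam0 / 4) := by
      by_contra h; exact hz (not_le.1 h)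
    refine ⟨fun t => s * N (t - a), by simp [N0], by simp only []; rw [← hL, NL, mul_zero], ?_, ?_⟩
    · intro t hat htb
      have := Nb (t - a) (by omega)
      simp only
      rw [← mul_assoc, ← sq, hs, one_mul]
      constructor <;> linarith
    · have e2 : (fun i => ycoord (-s) g1 z (L - 1 - i)) = ycoord (-s) g2 z := rfl
      rw [e2] at Nc
      have e3 : ∑ t ∈ Finset.Ico a b, (pad z t + (s * N (t + 1 - a) - s * N (t - a))) ^ 2 =
          ∑ t ∈ Finset.range L, (ycoord (-s) g1 z t - (N (t + 1) - N t)) ^ 2 := by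
        rw [Finset.sum_Ico_eq_sum_range]
        refine Finset.sum_congr rfl fun t _ => ?_
        simp only [ycoord, hg1]
        rw [show a + t + 1 - a = t + 1 by omega, show a + t - a = t by omega]
        linear_combination ((N (t+1) - N t) ^ 2 - pad z (a + t) ^ 2) * hs
      simp only
      linarith



/-! ### Convex geometry -/

/-- Dot product. -/
def dott {n : ℕ} (x y : Fin n → ℝ) : ℝ := ∑ i, x i * y i

lemma dott_comm {n : ℕ} (x y : Fin n → ℝ) : dott x y = dott y x := by simp [dott, mul_comm]
lemma dott_add_left {n : ℕ} (x y z : Fin n → ℝ) : dott (x + y) z = dott x z + dott y z := by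
  simp [dott, add_mul, Finset.sum_add_distrib]
lemma dott_sub_left {n : ℕ} (x y z : Fin n → ℝ) : dott (x - y) z = dott x z - dott y z := by
  simp [dott, sub_mul, Finset.sum_sub_distrib]
lemma dott_smul_left {n : ℕ} (c : ℝ) (y z : Fin n → ℝ) : dott (c • y) z = c * dott y z := by
  simp [dott, Finset.mul_sum, mul_assoc]
lemma dott_add_right {n : ℕ} (x y z : Fin n → ℝ) : dott z (x + y) = dott z x + dott z y := by
  rw [dott_comm, dott_add_left, dott_comm x, dott_comm y]
lemma dott_sub_right {n : ℕ} (x y z : Fin n → ℝ) : dott z (x - y) = dott z x - dott z y := by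
  rw [dott_comm, dott_sub_left, dott_comm x, dott_comm y]
lemma dott_smul_right {n : ℕ} (c : ℝ) (y z : Fin n → ℝ) : dott z (c • y) = c * dott z y := by
  rw [dott_comm, dott_smul_left, dott_comm y]
lemma dott_self {n : ℕ} (x : Fin n → ℝ) : dott x x = sqnorm x := by simp [dott, sqnorm, sq]
lemma sqnorm_nonneg {n : ℕ} (x : Fin n → ℝ) : 0 ≤ sqnorm x := Finset.sum_nonneg fun i _ => sq_nonneg _
lemma eunorm_nonneg {n : ℕ} (x : Fin n → ℝ) : 0 ≤ eunorm x := Real.sqrt_nonneg _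
lemma eunorm_sq {n : ℕ} (x : Fin n → ℝ) : eunorm x ^ 2 = sqnorm x := Real.sq_sqrt (sqnorm_nonneg x)
lemma dott_le {n : ℕ} (x y : Fin n → ℝ) : dott x y ≤ eunorm x * eunorm y :=
  Real.sum_mul_le_sqrt_mul_sqrt _ _ _
lemma sqnorm_sub {n : ℕ} (x y : Fin n → ℝ) : sqnorm (x - y) = sqnorm x - 2 * dott x y + sqnorm y := by
  rw [← dott_self, ← dott_self, ← dott_self, dott_sub_left, dott_sub_right, dott_sub_right, dott_comm y x]; ring
lemma sqnorm_add {n : ℕ} (x y : Fin n → ℝ) : sqnorm (x + y) = sqnorm x + 2 * dott x y + sqnorm y := by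
  rw [← dott_self, ← dott_self, ← dott_self, dott_add_left, dott_add_right, dott_add_right, dott_comm y x]; ring
lemma sqnorm_smul {n : ℕ} (c : ℝ) (x : Fin n → ℝ) : sqnorm (c • x) = c ^ 2 * sqnorm x := by
  rw [← dott_self, ← dott_self, dott_smul_left, dott_smul_right]; ring
lemma eunorm_add_le {n : ℕ} (x y : Fin n → ℝ) : eunorm (x + y) ≤ eunorm x + eunorm y := by
  rw [tf_eunorm_eq, tf_eunorm_eq, tf_eunorm_eq, WithLp.toLp_add]; exact norm_add_le _ _
lemma eunorm_smul {n : ℕ} (c : ℝ) (x : Fin n → ℝ) : eunorm (c • x) = |c| * eunorm x := by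
  unfold eunorm; rw [sqnorm_smul, Real.sqrt_mul (sq_nonneg _), Real.sqrt_sq_eq_abs]
lemma eunorm_neg {n : ℕ} (x : Fin n → ℝ) : eunorm (-x) = eunorm x := by
  simp [eunorm, sqnorm]
lemma eunorm_sub_comm {n : ℕ} (x y : Fin n → ℝ) : eunorm (x - y) = eunorm (y - x) := by
  rw [← eunorm_neg, neg_sub]
lemma eunorm_cont {n : ℕ} : Continuous (eunorm (n := n)) := by
  unfold eunorm sqnorm; fun_prop

lemma dist_bdd {n : ℕ} (z : Fin n → ℝ) (S : Set (Fin n → ℝ)) : BddBelow ((fun v => eunorm (z - v)) '' S) :=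
  ⟨0, by rintro _ ⟨v, -, rfl⟩; exact eunorm_nonneg _⟩

lemma dist_le {n : ℕ} {S : Set (Fin n → ℝ)} {v : Fin n → ℝ} (hv : v ∈ S) (z : Fin n → ℝ) (l : ℝ) :
    distSet z (scaleSet l S) ≤ eunorm (z - l • v) :=
  csInf_le (dist_bdd _ _) ⟨l • v, ⟨v, hv, rfl⟩, rfl⟩

lemma dist_attain {n : ℕ} {S : Set (Fin n → ℝ)} (hne : S.Nonempty) (hc : IsCompact S) (z : Fin n → ℝ) (l : ℝ) :
    ∃ v ∈ S, distSet z (scaleSet l S) = eunorm (z - l • v) := by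
  have hcont : ContinuousOn (fun v : Fin n → ℝ => eunorm (z - l • v)) S :=
    (eunorm_cont.comp (by fun_prop : Continuous fun v : Fin n → ℝ => z - l • v)).continuousOn
  obtain ⟨v, hv, hm⟩ := hc.exists_isMinOn hne hcont
  refine ⟨v, hv, le_antisymm (dist_le hv z l) ?_⟩
  refine le_csInf ⟨_, ⟨l • v, ⟨v, hv, rfl⟩, rfl⟩⟩ ?_
  rintro _ ⟨_, ⟨w, hw, rfl⟩, rfl⟩
  exact hm hw

lemma dist_nonneg' {n : ℕ} (z : Fin n → ℝ) (S : Set (Fin n → ℝ)) : 0 ≤ distSet z S :=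
  Real.sInf_nonneg (by rintro _ ⟨v, -, rfl⟩; exact eunorm_nonneg _)

lemma dist_lip {n : ℕ} {S : Set (Fin n → ℝ)} (hne : S.Nonempty) (hc : IsCompact S) (l : ℝ) (z z' : Fin n → ℝ) :
    |distSet z (scaleSet l S) - distSet z' (scaleSet l S)| ≤ eunorm (z - z') := by
  have key : ∀ z z' : Fin n → ℝ, distSet z (scaleSet l S) - distSet z' (scaleSet l S) ≤ eunorm (z - z') := by
    intro z z'
    obtain ⟨v, hv, he⟩ := dist_attain hne hc z' l
    have h1 := dist_le hv z l
    have h2 := eunorm_add_le (z - z') (z' - l • v)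
    rw [sub_add_sub_cancel] at h2
    linarith
  rw [abs_le]
  have := key z' z
  rw [eunorm_sub_comm] at this
  exact ⟨by linarith, key z z'⟩

lemma cone_comb {n : ℕ} {S : Set (Fin n → ℝ)} (hcv : Convex ℝ S) {v w : Fin n → ℝ} (hv : v ∈ S) (hw : w ∈ S)
    {a b : ℝ} (ha : 0 ≤ a) (hb : 0 ≤ b) : ∃ u ∈ S, a • v + b • w = (a + b) • u := by
  rcases (add_nonneg ha hb).eq_or_lt with h | h
  · have h1 : a = 0 := by linarith
    have h2 : b = 0 := by linarith
    exact ⟨v, hv, by simp [h1, h2]⟩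
  · refine ⟨(a / (a + b)) • v + (b / (a + b)) • w, hcv hv hw (by positivity) (by positivity) (by field_simp), ?_⟩
    rw [smul_add, smul_smul, smul_smul]
    congr 2 <;> field_simp

/-- Variational inequality for the projection on the cone generated by `S`. -/
lemma cone_var {n : ℕ} {S : Set (Fin n → ℝ)} (hcv : Convex ℝ S) (z : Fin n → ℝ) {L : ℝ} {s : Fin n → ℝ} (hL : 0 ≤ L)
    (hs : s ∈ S) (hmin : ∀ m : ℝ, 0 ≤ m → ∀ w ∈ S, eunorm (z - L • s) ≤ eunorm (z - m • w))
    {m : ℝ} {w : Fin n → ℝ} (hm : 0 ≤ m) (hw : w ∈ S) : dott (z - L • s) (m • w - L • s) ≤ 0 := by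
  have key : ∀ e : ℝ, 0 < e → e ≤ 1 → 2 * dott (z - L • s) (m • w - L • s) ≤ e * sqnorm (m • w - L • s) := by
    intro e he he1
    obtain ⟨u, hu, hue⟩ := cone_comb hcv hs hw (mul_nonneg (by linarith : 0 ≤ 1 - e) hL) (mul_nonneg he.le hm)
    have h1 := hmin _ (add_nonneg (mul_nonneg (by linarith : 0 ≤ 1 - e) hL) (mul_nonneg he.le hm)) u hu
    rw [← hue] at h1
    have h2 : z - (((1 - e) * L) • s + (e * m) • w) = (z - L • s) - e • (m • w - L • s) := by
      ext i; simp; ring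
    rw [h2] at h1
    have h3 := pow_le_pow_left₀ (eunorm_nonneg _) h1 2
    rw [eunorm_sq, eunorm_sq, sqnorm_sub (z - L • s) (e • _), sqnorm_smul e, dott_smul_right e] at h3
    have h4 : e * (2 * dott (z - L • s) (m • w - L • s)) ≤ e * (e * sqnorm (m • w - L • s)) := by nlinarith
    exact le_of_mul_le_mul_left h4 he
  by_contra hcon
  push Not at hcon
  set D := dott (z - L • s) (m • w - L • s)
  set Q := sqnorm (m • w - L • s)
  have hQ : 0 ≤ Q := sqnorm_nonneg _
  have h5 := key (min 1 (D / (Q + 1))) (lt_min one_pos (by positivity)) (min_le_left _ _)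
  have h6 : min 1 (D / (Q + 1)) * Q ≤ D := by
    calc _ ≤ D / (Q + 1) * (Q + 1) := by
          gcongr
          · exact min_le_right _ _
          · linarith
      _ = D := by field_simp
  linarith

lemma lam_lip {n : ℕ} {S : Set (Fin n → ℝ)} (hne : S.Nonempty) (hc : IsCompact S) (hcv : Convex ℝ S)
    (v0 : Fin n → ℝ) (hv0 : ∀ v ∈ S, dott v v0 = sqnorm v0) (hpos : 0 < eunorm v0)
    (lamfun : (Fin n → ℝ) → ℝ) (hlam : IsLamFun S lamfun) (z z' : Fin n → ℝ) :
    |lamfun z - lamfun z'| ≤ 1 / eunorm v0 * eunorm (z - z') := by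
  obtain ⟨s, hs, hse⟩ := dist_attain hne hc z (lamfun z)
  obtain ⟨s', hs', hse'⟩ := dist_attain hne hc z' (lamfun z')
  have m1 : ∀ m : ℝ, 0 ≤ m → ∀ w ∈ S, eunorm (z - lamfun z • s) ≤ eunorm (z - m • w) := fun m hm w hw => by
    rw [← hse]; exact ((hlam z).2 m hm).trans (dist_le hw z m)
  have m2 : ∀ m : ℝ, 0 ≤ m → ∀ w ∈ S, eunorm (z' - lamfun z' • s') ≤ eunorm (z' - m • w) := fun m hm w hw => by
    rw [← hse']; exact ((hlam z').2 m hm).trans (dist_le hw z' m)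
  have k1 := cone_var hcv z (hlam z).1 hs m1 (hlam z').1 hs'
  have k2 := cone_var hcv z' (hlam z').1 hs' m2 (hlam z).1 hs
  set p := lamfun z • s with hp
  set p' := lamfun z' • s' with hp'
  have k3 : sqnorm (p - p') ≤ dott (z - z') (p - p') := by
    rw [← dott_self]
    simp only [dott_sub_left, dott_sub_right] at *
    linarith
  have k4 := dott_le (z - z') (p - p')
  have k5 : eunorm (p - p') ≤ eunorm (z - z') := by
    rcases (eunorm_nonneg (p - p')).eq_or_lt with h | h
    · rw [← h]; exact eunorm_nonneg _
    · rw [← eunorm_sq] at k3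
      have : eunorm (p - p') * eunorm (p - p') ≤ eunorm (z - z') * eunorm (p - p') := by nlinarith
      exact le_of_mul_le_mul_right this h
  have k6 : dott (p - p') v0 = (lamfun z - lamfun z') * eunorm v0 ^ 2 := by
    rw [dott_sub_left, hp, hp', dott_smul_left, dott_smul_left, hv0 s hs, hv0 s' hs', eunorm_sq]; ring
  have k7 : |dott (p - p') v0| ≤ eunorm (p - p') * eunorm v0 := by
    rw [abs_le]
    have h1 := dott_le (p - p') v0
    have h2 := dott_le (p' - p) v0
    rw [eunorm_sub_comm] at h2
    simp only [dott_sub_left] at *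
    constructor <;> linarith
  rw [k6, abs_mul, abs_of_nonneg (sq_nonneg (eunorm v0))] at k7
  have k8 : |lamfun z - lamfun z'| * eunorm v0 ≤ eunorm (p - p') := by
    have : (|lamfun z - lamfun z'| * eunorm v0) * eunorm v0 ≤ eunorm (p - p') * eunorm v0 := by nlinarith
    exact le_of_mul_le_mul_right this hpos
  rw [one_div, inv_mul_eq_div, le_div_iff₀ hpos]
  linarith

lemma combine {n : ℕ} {S : Set (Fin n → ℝ)} (hc : IsCompact S) (hcv : Convex ℝ S)
    (v0 : Fin n → ℝ) (hv0S : v0 ∈ S) (hv0 : ∀ v ∈ S, dott v v0 = sqnorm v0) (hpos : 0 < eunorm v0)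
    (lamfun : (Fin n → ℝ) → ℝ) (hlam : IsLamFun S lamfun) (lamstar lam lam0 B : ℝ)
    (hls : lamstar = (∫ z, lamfun z ∂gaussVec n 1) + 2 / eunorm v0) (hl : lamstar ≤ lam) (hl0 : 0 ≤ lam0)
    (hB : ∫ z, distSet z (scaleSet lam0 S) ^ 2 ∂gaussVec n 1 ≤ B) :
    0 < lam ∧ Integrable (fun z => distSet z (scaleSet lam S) ^ 2) (gaussVec n 1) ∧
    ∫ z, distSet z (scaleSet lam S) ^ 2 ∂gaussVec n 1 ≤ 10 * (B + (lam - lamstar) ^ 2 * sqnorm v0 + 8) + 2 := by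
  have hne : S.Nonempty := ⟨v0, hv0S⟩
  set V := eunorm v0 with hV
  obtain ⟨cL, mL, vL⟩ := tf_gauss_lip lamfun (1 / V) (by positivity) (lam_lip hne hc hcv v0 hv0 hpos lamfun hlam)
  obtain ⟨cF, mF, vF⟩ := tf_gauss_lip (fun z => distSet z (scaleSet lam S)) 1 (by norm_num)
    (fun z z' => by rw [one_mul]; exact dist_lip hne hc lam z z')
  obtain ⟨cG, mG, vG⟩ := tf_gauss_lip (fun z => distSet z (scaleSet lam0 S)) 1 (by norm_num)
    (fun z z' => by rw [one_mul]; exact dist_lip hne hc lam0 z z')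
  set EL := ∫ z, lamfun z ∂gaussVec n 1 with hEL
  set F : (Fin n → ℝ) → ℝ := fun z => distSet z (scaleSet lam S) with hF
  set G : (Fin n → ℝ) → ℝ := fun z => distSet z (scaleSet lam0 S) with hG
  set e := ∫ z, F z ∂gaussVec n 1 with he
  have hEL0 : 0 ≤ EL := integral_nonneg fun z => (hlam z).1
  have he0 : 0 ≤ e := integral_nonneg fun z => dist_nonneg' _ _
  have hlp : 0 < lam := by
    have : 0 < 2 / V := by positivity
    linarith
  have iF : Integrable F (gaussVec n 1) := mF.integrable (by norm_num)
  have iF2 := mF.integrable_sq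
  have iG2 := mG.integrable_sq
  have iL2 : Integrable (fun z => (lamfun z - EL) ^ 2) (gaussVec n 1) := (mL.sub (memLp_const EL)).integrable_sq
  have iFe2 : Integrable (fun z => (F z - e) ^ 2) (gaussVec n 1) := (mF.sub (memLp_const e)).integrable_sq
  refine ⟨hlp, iF2, ?_⟩
  -- the good event
  set A : Set (Fin n → ℝ) := {z | lamfun z ≤ lamstar} with hA
  have hAm : MeasurableSet A := (isClosed_le cL continuous_const).measurableSet
  have hPA : 1 / 2 ≤ (gaussVec n 1).real A := by
    have h1 : (gaussVec n 1).real Aᶜ * (2 / V) ^ 2 ≤ 2 * (1 / V) ^ 2 := by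
      refine le_trans ?_ vL
      have : (gaussVec n 1).real Aᶜ * (2 / V) ^ 2 = ∫ z, Aᶜ.indicator (fun _ => (2 / V) ^ 2) z ∂gaussVec n 1 := by
        rw [integral_indicator_const _ hAm.compl, smul_eq_mul]
      rw [this]
      refine integral_mono ((integrable_const _).indicator hAm.compl) iL2 fun z => ?_
      by_cases hz : z ∈ A
      · rw [Set.indicator_of_notMem (by simpa using hz)]; positivity
      · rw [Set.indicator_of_mem (by simpa using hz)]
        have : lamstar < lamfun z := not_le.1 hz
        have h2 : 0 < 2 / V := by positivity
        exact pow_le_pow_left₀ h2.le (by linarith) 2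
    rw [measureReal_compl hAm] at h1
    simp only [probReal_univ] at h1
    rw [div_pow, div_pow, one_pow] at h1
    have h3 : 0 < 1 / V ^ 2 := by positivity
    have h4 : (1 - (gaussVec n 1).real A) * 4 * (1 / V ^ 2) ≤ 2 * (1 / V ^ 2) := by
      calc _ = (1 - (gaussVec n 1).real A) * (2 ^ 2 / V ^ 2) := by ring
        _ ≤ _ := h1
    have := le_of_mul_le_mul_right h4 h3
    linarith
  have hpt : ∀ z ∈ A, e ≤ G z + (lam - lamstar) * V + 2 + (EL - lamfun z) * V - (F z - e) := by
    intro z hz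
    obtain ⟨s, hs, hse⟩ := dist_attain hne hc z (lamfun z)
    have hz' : lamfun z ≤ lam := le_trans hz hl
    obtain ⟨u, hu, hue⟩ := cone_comb hcv hs hv0S (hlam z).1 (by linarith : 0 ≤ lam - lamfun z)
    rw [add_sub_cancel] at hue
    have h1 : F z ≤ eunorm (z - lam • u) := dist_le hu z lam
    have h2 : z - lam • u = (z - lamfun z • s) + (-(lam - lamfun z)) • v0 := by
      rw [← hue]; ext i; simp; ring
    have h3 := eunorm_add_le (z - lamfun z • s) ((-(lam - lamfun z)) • v0)
    rw [← h2, eunorm_smul, abs_neg, abs_of_nonneg (by linarith), ← hse] at h3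
    have h4 : distSet z (scaleSet (lamfun z) S) ≤ G z := (hlam z).2 lam0 hl0
    have h5 : (lam - lamfun z) * V = (lam - lamstar) * V + 2 + (EL - lamfun z) * V := by
      have : (2 / V) * V = 2 := by field_simp
      rw [hls]; linear_combination this
    linarith
  set R : (Fin n → ℝ) → ℝ := fun z => 5 * (G z ^ 2 + ((lam - lamstar) * V) ^ 2 + 4 + (lamfun z - EL) ^ 2 * V ^ 2 + (F z - e) ^ 2) with hR
  have iR : Integrable R (gaussVec n 1) :=
    ((((iG2.add (integrable_const _)).add (integrable_const _)).add (iL2.mul_const _)).add iFe2).const_mul 5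
  have hpt2 : ∀ z, A.indicator (fun _ => e ^ 2) z ≤ R z := by
    intro z
    by_cases hz : z ∈ A
    · rw [Set.indicator_of_mem hz]
      have h1 := pow_le_pow_left₀ he0 (hpt z hz) 2
      refine h1.trans ?_
      simp only [hR]
      have h5 : ∀ a b c d f : ℝ, (a + b + c + d - f) ^ 2 ≤ 5 * (a ^ 2 + b ^ 2 + c ^ 2 + d ^ 2 + f ^ 2) := by
        intro a b c d f
        nlinarith [sq_nonneg (a - b), sq_nonneg (a - c), sq_nonneg (a - d), sq_nonneg (a + f), sq_nonneg (b - c), sq_nonneg (b - d),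
          sq_nonneg (b + f), sq_nonneg (c - d), sq_nonneg (c + f), sq_nonneg (d + f)]
      have h6 := h5 (G z) ((lam - lamstar) * V) 2 ((EL - lamfun z) * V) (F z - e)
      refine h6.trans (le_of_eq ?_)
      ring
    · rw [Set.indicator_of_notMem hz]; simp only [hR]; positivity
  have hIR : ∫ z, R z ∂gaussVec n 1 ≤ 5 * (B + ((lam - lamstar) * V) ^ 2 + 4 + 2 + 2) := by
    simp only [hR]
    rw [integral_const_mul]
    have e1 : ∫ z, (G z ^ 2 + ((lam - lamstar) * V) ^ 2 + 4 + (lamfun z - EL) ^ 2 * V ^ 2 + (F z - e) ^ 2) ∂gaussVec n 1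
        = (∫ z, G z ^ 2 ∂gaussVec n 1) + ((lam - lamstar) * V) ^ 2 + 4 + (∫ z, (lamfun z - EL) ^ 2 ∂gaussVec n 1) * V ^ 2 + ∫ z, (F z - e) ^ 2 ∂gaussVec n 1 := by
      have j1 : Integrable (fun z => G z ^ 2 + ((lam - lamstar) * V) ^ 2) (gaussVec n 1) := iG2.add (integrable_const _)
      have j2 : Integrable (fun z => G z ^ 2 + ((lam - lamstar) * V) ^ 2 + 4) (gaussVec n 1) := j1.add (integrable_const _)
      have j3 : Integrable (fun z => G z ^ 2 + ((lam - lamstar) * V) ^ 2 + 4 + (lamfun z - EL) ^ 2 * V ^ 2) (gaussVec n 1) :=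
        j2.add (iL2.mul_const _)
      rw [integral_add j3 iFe2, integral_add j2 (iL2.mul_const _), integral_add j1 (integrable_const _),
        integral_add iG2 (integrable_const _), integral_mul_const]
      simp
    rw [e1]
    have h1 : (∫ z, (lamfun z - EL) ^ 2 ∂gaussVec n 1) * V ^ 2 ≤ 2 := by
      calc _ ≤ (2 * (1 / V) ^ 2) * V ^ 2 := by gcongr
        _ = 2 := by field_simp
    have h2 : ∫ z, (F z - e) ^ 2 ∂gaussVec n 1 ≤ 2 := by simpa using vF
    have h3 : ∫ z, G z ^ 2 ∂gaussVec n 1 ≤ B := hB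
    gcongr
  have hfin : (gaussVec n 1).real A * e ^ 2 ≤ ∫ z, R z ∂gaussVec n 1 := by
    have : (gaussVec n 1).real A * e ^ 2 = ∫ z, A.indicator (fun _ => e ^ 2) z ∂gaussVec n 1 := by
      rw [integral_indicator_const _ hAm, smul_eq_mul]
    rw [this]
    exact integral_mono ((integrable_const _).indicator hAm) iR hpt2
  have he2 : e ^ 2 ≤ 10 * (B + (lam - lamstar) ^ 2 * sqnorm v0 + 8) := by
    have h1 : 1 / 2 * e ^ 2 ≤ (gaussVec n 1).real A * e ^ 2 := by gcongr
    rw [← eunorm_sq]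
    nlinarith
  have hvar : ∫ z, (F z - e) ^ 2 ∂gaussVec n 1 = (∫ z, F z ^ 2 ∂gaussVec n 1) - e ^ 2 := by
    have : ∀ z, (F z - e) ^ 2 = F z ^ 2 - 2 * e * F z + e ^ 2 := fun z => by ring
    simp_rw [this]
    have j1 : Integrable (fun z => F z ^ 2 - 2 * e * F z) (gaussVec n 1) := iF2.sub (iF.const_mul _)
    rw [integral_add j1 (integrable_const _), integral_sub iF2 (iF.const_mul _), integral_const_mul]
    simp
    ring
  have h2 : ∫ z, (F z - e) ^ 2 ∂gaussVec n 1 ≤ 2 := by simpa using vF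
  show ∫ z, F z ^ 2 ∂gaussVec n 1 ≤ _
  linarith



/-! ### The total variation functional and its subdifferential -/

/-- First differences of a finite vector. -/
def jmp {n : ℕ} (θ : Fin n → ℝ) (t : ℕ) : ℝ := pad θ (t + 1) - pad θ t

/-- Total variation. -/
def tvf {n : ℕ} (θ : Fin n → ℝ) : ℝ := ∑ t ∈ Finset.range (n - 1), |jmp θ t|

lemma Dl1_eq {n : ℕ} (θ : Fin n → ℝ) : Dl1 1 θ = tvf θ := rfl

lemma pad_add {n : ℕ} (x y : Fin n → ℝ) (t : ℕ) : pad (x + y) t = pad x t + pad y t := by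
  unfold pad; split <;> simp

lemma pad_smul {n : ℕ} (c : ℝ) (x : Fin n → ℝ) (t : ℕ) : pad (c • x) t = c * pad x t := by
  unfold pad; split <;> simp

lemma jmp_add {n : ℕ} (x y : Fin n → ℝ) (t : ℕ) : jmp (x + y) t = jmp x t + jmp y t := by
  simp only [jmp, pad_add]; ring

lemma jmp_smul {n : ℕ} (c : ℝ) (x : Fin n → ℝ) (t : ℕ) : jmp (c • x) t = c * jmp x t := by
  simp only [jmp, pad_smul]; ring

lemma tvf_comb {n : ℕ} (x y : Fin n → ℝ) (a b : ℝ) (ha : 0 ≤ a) (hb : 0 ≤ b) :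
    tvf (a • x + b • y) ≤ a * tvf x + b * tvf y := by
  unfold tvf
  rw [Finset.mul_sum, Finset.mul_sum, ← Finset.sum_add_distrib]
  refine Finset.sum_le_sum fun t _ => ?_
  rw [jmp_add, jmp_smul, jmp_smul]
  refine (abs_add_le _ _).trans ?_
  rw [abs_mul, abs_mul, abs_of_nonneg ha, abs_of_nonneg hb]

lemma mem_sub {n : ℕ} {g : (Fin n → ℝ) → ℝ} {θ v : Fin n → ℝ} : v ∈ subdiff g θ ↔ ∀ y, g θ + dott v (y - θ) ≤ g y := Iff.rfl

lemma sub_convex {n : ℕ} (g : (Fin n → ℝ) → ℝ) (θ : Fin n → ℝ) : Convex ℝ (subdiff g θ) := by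
  intro v hv w hw a b ha hb hab
  rw [mem_sub] at *
  intro y
  rw [dott_add_left, dott_smul_left, dott_smul_left]
  have h1 := mul_le_mul_of_nonneg_left (hv y) ha
  have h2 := mul_le_mul_of_nonneg_left (hw y) hb
  have h3 : b = 1 - a := by linarith
  subst h3
  nlinarith

lemma sub_compact {n : ℕ} (g : (Fin n → ℝ) → ℝ) (θ : Fin n → ℝ) : IsCompact (subdiff g θ) := by
  have hcl : IsClosed (subdiff g θ) := by
    have : subdiff g θ = ⋂ y, {v | g θ + ∑ i, v i * (y i - θ i) ≤ g y} := by
      ext v; simp [subdiff]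
    rw [this]
    exact isClosed_iInter fun y => isClosed_le (by fun_prop) continuous_const
  have hbox : IsCompact (Set.univ.pi fun i : Fin n => Set.Icc (-(g (θ + (-1:ℝ) • Pi.single i 1) - g θ)) (g (θ + (1:ℝ) • Pi.single i 1) - g θ)) :=
    isCompact_univ_pi fun i => isCompact_Icc
  refine hbox.of_isClosed_subset hcl ?_
  intro v hv i _
  have key : ∀ c : ℝ, c * v i ≤ g (θ + c • Pi.single i 1) - g θ := by
    intro c
    have h1 := mem_sub.1 hv (θ + c • Pi.single i 1)
    rw [add_sub_cancel_left, dott_smul_right] at h1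
    have : dott v (Pi.single i 1) = v i := by
      unfold dott
      rw [Finset.sum_eq_single i] <;> simp +contextual [Pi.single_apply]
    rw [this] at h1
    linarith
  constructor
  · have := key (-1); linarith
  · have := key 1; linarith

/-- `v = -dW` as a vector. -/
def negd {n : ℕ} (W : ℕ → ℝ) : Fin n → ℝ := fun i => W i - W (i + 1)

lemma dott_negd {n : ℕ} (W : ℕ → ℝ) (h0 : W 0 = 0) (hn : W n = 0) (u : Fin n → ℝ) :
    dott (negd W) u = ∑ t ∈ Finset.range (n - 1), W (t + 1) * jmp u t := by
  have h1 : dott (negd W) u = ∑ t ∈ Finset.range n, (W t - W (t + 1)) * pad u t := by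
    rw [Finset.sum_range]
    unfold dott negd
    refine Finset.sum_congr rfl fun i _ => ?_
    rw [pad_apply _ _ i.2]
  rw [h1]
  have key : ∀ m, ∑ t ∈ Finset.range (m + 1), (W t - W (t + 1)) * pad u t =
      W 0 * pad u 0 - W (m + 1) * pad u m + ∑ t ∈ Finset.range m, W (t + 1) * jmp u t := by
    intro m
    induction m with
    | zero => simp; ring
    | succ m ih => rw [Finset.sum_range_succ, ih, Finset.sum_range_succ]; unfold jmp; ring
  cases n with
  | zero => simp
  | succ m => rw [key m, h0, hn]; simp

lemma negd_mem {n : ℕ} (θ : Fin n → ℝ) (W : ℕ → ℝ) (h0 : W 0 = 0) (hn : W n = 0)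
    (hb : ∀ t < n - 1, |W (t + 1)| ≤ 1) (hj : ∀ t < n - 1, W (t + 1) * jmp θ t = |jmp θ t|) :
    negd W ∈ subdiff (fun α => Dl1 1 α) θ := by
  rw [mem_sub]
  intro y
  simp only [Dl1_eq]
  rw [dott_sub_right, dott_negd W h0 hn, dott_negd W h0 hn]
  have h1 : ∑ t ∈ Finset.range (n - 1), W (t + 1) * jmp θ t = tvf θ :=
    Finset.sum_congr rfl fun t ht => hj t (Finset.mem_range.1 ht)
  have h2 : ∑ t ∈ Finset.range (n - 1), W (t + 1) * jmp y t ≤ tvf y := by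
    refine Finset.sum_le_sum fun t ht => ?_
    refine (le_abs_self _).trans ?_
    rw [abs_mul]
    have := hb t (Finset.mem_range.1 ht)
    nlinarith [abs_nonneg (jmp y t)]
  linarith

lemma exists_eps (J d : ℕ → ℝ) (m : ℕ) (h : ∀ t < m, J t = 0 → d t = 0) :
    ∃ e : ℝ, 0 < e ∧ ∀ t < m, e * |d t| ≤ |J t| := by
  induction m with
  | zero => exact ⟨1, one_pos, by simp⟩
  | succ m ih =>
    obtain ⟨e, he, hm⟩ := ih fun t ht => h t (by omega)
    by_cases hJ : J m = 0
    · refine ⟨e, he, fun t ht => ?_⟩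
      rcases Nat.lt_succ_iff_lt_or_eq.1 ht with h1 | h1
      · exact hm t h1
      · subst h1; simp [h t ht hJ]
    · have hp : 0 < |J m| := abs_pos.2 hJ
      refine ⟨min e (|J m| / (|d m| + 1)), lt_min he (by positivity), fun t ht => ?_⟩
      rcases Nat.lt_succ_iff_lt_or_eq.1 ht with h1 | h1
      · refine le_trans ?_ (hm t h1)
        gcongr
        exact min_le_left _ _
      · subst h1
        calc min e (|J t| / (|d t| + 1)) * |d t| ≤ |J t| / (|d t| + 1) * (|d t| + 1) := by
              gcongr
              · exact min_le_right _ _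
              · linarith
          _ = |J t| := by field_simp

lemma dott_const {n : ℕ} (θ u v v' : Fin n → ℝ) (hu : ∀ t < n - 1, jmp θ t = 0 → jmp u t = 0)
    (hv : v ∈ subdiff (fun α => Dl1 1 α) θ) (hv' : v' ∈ subdiff (fun α => Dl1 1 α) θ) : dott v u ≤ dott v' u := by
  obtain ⟨e, he, hm⟩ := exists_eps (jmp θ) (jmp u) (n - 1) hu
  have h1 := mem_sub.1 hv (θ + e • u)
  have h2 := mem_sub.1 hv' (θ + (-e) • u)
  simp only [Dl1_eq, add_sub_cancel_left, dott_smul_right] at h1 h2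
  have h3 : tvf (θ + e • u) + tvf (θ + (-e) • u) ≤ 2 * tvf θ := by
    unfold tvf
    rw [← Finset.sum_add_distrib, Finset.mul_sum]
    refine Finset.sum_le_sum fun t ht => ?_
    have h4 := hm t (Finset.mem_range.1 ht)
    rw [jmp_add, jmp_add, jmp_smul, jmp_smul]
    have h5 : |e * jmp u t| ≤ |jmp θ t| := by rw [abs_mul, abs_of_pos he]; exact h4
    rw [neg_mul]
    generalize e * jmp u t = x at h5
    generalize jmp θ t = y at h5
    rcases abs_cases x with ⟨hx, _⟩ | ⟨hx, _⟩ <;> rcases abs_cases y with ⟨hy, _⟩ | ⟨hy, _⟩ <;>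
    rcases abs_cases (y + x) with ⟨ha, _⟩ | ⟨ha, _⟩ <;> rcases abs_cases (y + -x) with ⟨hb, _⟩ | ⟨hb, _⟩ <;> linarith
  have h4 : e * (dott v u - dott v' u) ≤ 0 := by linarith
  have := nonpos_of_mul_nonpos_right h4 he
  linarith

lemma v0_eq {n : ℕ} (θ vl v0 : Fin n → ℝ) (hu : ∀ t < n - 1, jmp θ t = 0 → jmp vl t = 0)
    (hvl : vl ∈ subdiff (fun α => Dl1 1 α) θ)
    (hv0 : IsMinNormIn v0 ((affineSpan ℝ (subdiff (fun α => Dl1 1 α) θ) : Set (Fin n → ℝ)))) :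
    v0 = vl ∧ ∀ v ∈ subdiff (fun α => Dl1 1 α) θ, dott v v0 = sqnorm v0 := by
  have hS : ∀ v ∈ subdiff (fun α => Dl1 1 α) θ, dott v vl = sqnorm vl := by
    intro v hv
    rw [← dott_self]
    exact le_antisymm (dott_const θ vl v vl hu hv hvl) (dott_const θ vl vl v hu hvl hv)
  have hA : dott v0 vl = sqnorm vl := by
    refine affineSpan_induction (p := fun w => dott w vl = sqnorm vl) hv0.1 hS ?_
    intro c u v w hu hv hw
    simp only [vsub_eq_sub, vadd_eq_add]
    rw [dott_add_left, dott_smul_left, dott_sub_left, hu, hv, hw]; ring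
  have hle := pow_le_pow_left₀ (eunorm_nonneg _) (hv0.2 vl (subset_affineSpan ℝ _ hvl)) 2
  rw [eunorm_sq, eunorm_sq] at hle
  have h0 : sqnorm (v0 - vl) ≤ 0 := by rw [sqnorm_sub, hA]; linarith
  have : v0 = vl := by
    ext i
    have h1 : (v0 i - vl i) ^ 2 ≤ sqnorm (v0 - vl) :=
      Finset.single_le_sum (f := fun i => ((v0 - vl) i) ^ 2) (fun i _ => sq_nonneg _) (Finset.mem_univ i)
    have h2 : (v0 i - vl i) ^ 2 = 0 := le_antisymm (h1.trans h0) (sq_nonneg _)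
    have := pow_eq_zero_iff (two_ne_zero) |>.1 h2
    linarith
  subst this
  exact ⟨rfl, hS⟩

/-! ### The risk bound -/

lemma est_bound {n : ℕ} (σ lam : ℝ) (hσ : 0 < σ) (hlam : 0 ≤ lam) (est : (Fin n → ℝ) → Fin n → ℝ)
    (he : IsPenEst 1 σ lam est) (θ v : Fin n → ℝ) (hv : v ∈ subdiff (fun α => Dl1 1 α) θ) (ξ : Fin n → ℝ) :
    eunorm (est (θ + ξ) - θ) ≤ eunorm (ξ - (σ * lam) • v) := by
  set x := est (θ + ξ) with hx
  set d := x - θ with hd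
  have hmin : ∀ y, 1 / 2 * sqnorm (θ + ξ - x) + σ * lam * tvf x ≤ 1 / 2 * sqnorm (θ + ξ - y) + σ * lam * tvf y := by
    intro y; have := he (θ + ξ) y; simpa [Dl1_eq] using this
  have hsl : 0 ≤ σ * lam := by positivity
  have hsub := mem_sub.1 hv x
  simp only [Dl1_eq] at hsub
  rw [← hd] at hsub
  have e0 : θ + ξ - x = ξ - d := by rw [hd]; ext i; simp; ring
  have key : ∀ a : ℝ, 0 < a → a ≤ 1 → dott (ξ - (σ * lam) • v) d ≥ sqnorm d - a / 2 * sqnorm d := by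
    intro a ha ha1
    have h1 := hmin ((1 - a) • x + a • θ)
    have h2 := tvf_comb x θ (1 - a) a (by linarith) ha.le
    have e1 : θ + ξ - ((1 - a) • x + a • θ) = (ξ - d) + a • d := by rw [hd]; ext i; simp; ring
    rw [e0, e1, sqnorm_add (ξ - d), sqnorm_smul, dott_smul_right, dott_sub_left, dott_self] at h1
    have h3 := mul_le_mul_of_nonneg_left h2 hsl
    have h4 := mul_le_mul_of_nonneg_left hsub hsl
    rw [dott_sub_left, dott_smul_left]
    have h5 : a * (sqnorm d - a / 2 * sqnorm d) ≤ a * (dott ξ d - σ * lam * dott v d) := by nlinarith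
    exact le_of_mul_le_mul_left h5 ha
  have h6 : sqnorm d ≤ dott (ξ - (σ * lam) • v) d := by
    by_contra hcon
    push Not at hcon
    have hq := sqnorm_nonneg d
    set D := dott (ξ - (σ * lam) • v) d
    set Q := sqnorm d
    have h7 := key (min 1 ((Q - D) / (Q + 1))) (lt_min one_pos (div_pos (by linarith) (by linarith))) (min_le_left _ _)
    have h8 : min 1 ((Q - D) / (Q + 1)) * Q ≤ Q - D := by
      calc _ ≤ (Q - D) / (Q + 1) * (Q + 1) := by
            exact mul_le_mul (min_le_right _ _) (by linarith) hq (div_nonneg (by linarith) (by linarith))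
        _ = Q - D := by field_simp
    linarith
  have h9 := dott_le (ξ - (σ * lam) • v) d
  rcases (eunorm_nonneg d).eq_or_lt with h | h
  · rw [← h]; exact eunorm_nonneg _
  · rw [← eunorm_sq] at h6
    have : eunorm d * eunorm d ≤ eunorm (ξ - (σ * lam) • v) * eunorm d := by nlinarith
    exact le_of_mul_le_mul_right this h

lemma gaussVec_scale (n : ℕ) (σ : ℝ) : MeasurePreserving (fun z : Fin n → ℝ => fun i => σ * z i) (gaussVec n 1) (gaussVec n σ) := by
  unfold gaussVec
  refine measurePreserving_pi (f := fun _ x => σ * x) _ _ (fun i => ⟨by fun_prop, ?_⟩)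
  rw [gaussianReal_map_const_mul]
  congr 1
  · simp
  · ext; simp [sq_nonneg]

lemma risk_bound {n : ℕ} (σ lam : ℝ) (hσ : 0 < σ) (hlam : 0 ≤ lam) (est : (Fin n → ℝ) → Fin n → ℝ)
    (he : IsPenEst 1 σ lam est) (θ : Fin n → ℝ) (hne : (subdiff (fun α => Dl1 1 α) θ).Nonempty)
    (hi : Integrable (fun z => distSet z (scaleSet lam (subdiff (fun α => Dl1 1 α) θ)) ^ 2) (gaussVec n 1)) :
    risk σ est θ ≤ σ ^ 2 / n * ∫ z, distSet z (scaleSet lam (subdiff (fun α => Dl1 1 α) θ)) ^ 2 ∂gaussVec n 1 := by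
  set S := subdiff (fun α => Dl1 1 α) θ with hS
  have hsc := gaussVec_scale n σ
  have hemb : MeasurableEmbedding (fun z : Fin n → ℝ => fun i => σ * z i) := by
    have : (fun z : Fin n → ℝ => fun i => σ * z i) = fun z => (Units.mk0 σ hσ.ne') • z := by
      ext z i; simp [Units.smul_def]
    rw [this]
    exact measurableEmbedding_const_smul _
  unfold risk
  rw [← hsc.map_eq, hemb.integral_map]
  have h1 : ∫ z : Fin n → ℝ, sqnorm (est (θ + fun i => σ * z i) - θ) ∂gaussVec n 1 ≤ 
      ∫ z, σ ^ 2 * distSet z (scaleSet lam S) ^ 2 ∂gaussVec n 1 := by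
    refine integral_mono_of_nonneg (Filter.Eventually.of_forall fun z => sqnorm_nonneg _) (hi.const_mul _)
      (Filter.Eventually.of_forall fun z => ?_)
    obtain ⟨v, hv, hve⟩ := dist_attain hne (sub_compact _ θ) z lam
    have h2 := est_bound σ lam hσ hlam est he θ v hv (fun i => σ * z i)
    have h3 : (fun i => σ * z i) - (σ * lam) • v = σ • (z - lam • v) := by ext i; simp; ring
    rw [h3, eunorm_smul, abs_of_pos hσ, ← hve] at h2
    simp only
    rw [← eunorm_sq, ← mul_pow]
    exact pow_le_pow_left₀ (eunorm_nonneg _) h2 2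
  rw [integral_const_mul] at h1
  calc _ ≤ 1 / (n:ℝ) * (σ ^ 2 * ∫ z, distSet z (scaleSet lam S) ^ 2 ∂gaussVec n 1) := by gcongr
    _ = _ := by ring



/-! ### Gluing excursions -/

/-- There is a correction `N` on `[a, b]` of expected cost at most `X`. -/
def Good (n : ℕ) (w : ℕ → ℝ) (Brk : ℕ → Prop) (lam0 : ℝ) (a b : ℕ) (X : ℝ) : Prop :=
  ∃ c : (Fin n → ℝ) → ℝ, Integrable c (gaussVec n 1) ∧ ∫ z, c z ∂gaussVec n 1 ≤ X ∧
    ∀ z, ∃ N : ℕ → ℝ, N a = 0 ∧ N b = 0 ∧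
      (∀ t, a ≤ t → t ≤ b → |lam0 * w t + N t| ≤ lam0 ∧ (Brk t → N t = 0)) ∧
        ∑ t ∈ Finset.Ico a b, (pad z t + (N (t + 1) - N t)) ^ 2 ≤ c z

lemma Good.mono {n : ℕ} {w : ℕ → ℝ} {Brk : ℕ → Prop} {lam0 : ℝ} {a b : ℕ} {X Y : ℝ} (h : Good n w Brk lam0 a b X) (hXY : X ≤ Y) :
    Good n w Brk lam0 a b Y := by
  obtain ⟨c, h1, h2, h3⟩ := h
  exact ⟨c, h1, h2.trans hXY, h3⟩

lemma Good.glue {n : ℕ} {w : ℕ → ℝ} {Brk : ℕ → Prop} {lam0 : ℝ} {a b d : ℕ} {X Y : ℝ} (hab : a ≤ b) (hbd : b ≤ d)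
    (h : Good n w Brk lam0 a b X) (h' : Good n w Brk lam0 b d Y) : Good n w Brk lam0 a d (X + Y) := by
  obtain ⟨c, h1, h2, h3⟩ := h
  obtain ⟨c', h1', h2', h3'⟩ := h'
  refine ⟨fun z => c z + c' z, h1.add h1', ?_, fun z => ?_⟩
  · rw [integral_add h1 h1']; linarith
  · obtain ⟨N, Na, Nb, Nt, Nc⟩ := h3 z
    obtain ⟨N', Na', Nb', Nt', Nc'⟩ := h3' z
    refine ⟨fun t => if t ≤ b then N t else N' t, by simp [hab, Na], ?_, ?_, ?_⟩
    · by_cases hd : d ≤ b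
      · have : d = b := le_antisymm hd hbd
        subst this; simp [Nb]
      · simp [hd, Nb']
    · intro t hat htd
      by_cases htb : t ≤ b
      · simp only [htb, if_true]; exact Nt t hat htb
      · simp only [htb, if_false]; exact Nt' t (by omega) htd
    · rw [← Finset.sum_Ico_consecutive _ hab hbd]
      refine add_le_add (le_trans (le_of_eq (Finset.sum_congr rfl fun t ht => ?_)) Nc)
        (le_trans (le_of_eq (Finset.sum_congr rfl fun t ht => ?_)) Nc')
      · rw [Finset.mem_Ico] at ht
        simp only [show t + 1 ≤ b by omega, show t ≤ b by omega, if_true]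
      · rw [Finset.mem_Ico] at ht
        simp only [show ¬ (t + 1 ≤ b) by omega, if_false]
        by_cases htb : t ≤ b
        · have : t = b := by omega
          subst this; simp [Nb, Na']
        · simp only [htb, if_false]

lemma good_half {n : ℕ} (w : ℕ → ℝ) (Brk : ℕ → Prop) (M : ℕ) (hM : 1 ≤ M) (lam0 : ℝ) (hl0 : 0 ≤ lam0)
    (hl : lam0 ^ 2 = 96 * M * (1 + Real.log M)) (s : ℝ) (hs : s ^ 2 = 1) (b : ℕ) (hbn : b ≤ n) (L : ℕ) :
    ∀ a, a + L = b → (∀ t, a ≤ t → t ≤ b → |w t| ≤ 1) → (∀ t, a < t → t < b → s * w t ≤ 0 ∧ ¬ Brk t) →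
      Good n w Brk lam0 a b (400 * (1 + Real.log M) * ((L : ℝ) / M + 1)) := by
  have hMr : (1:ℝ) ≤ M := by exact_mod_cast hM
  have hlog : 0 ≤ Real.log M := Real.log_nonneg hMr
  have hs1 : |s| = 1 := by rw [← abs_one]; exact sq_eq_sq_iff_abs_eq_abs _ _ |>.1 (by rw [hs]; norm_num)
  have hmk : ∀ a b, a ≤ b → b ≤ n → b - a ≤ M → (∀ t, a ≤ t → t ≤ b → |w t| ≤ 1) → (∀ t, a < t → t < b → s * w t ≤ 0 ∧ ¬ Brk t) →
      Good n w Brk lam0 a b (400 * (1 + Real.log M)) := by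
    intro a b hab hbn hbM hw1 hw2
    obtain ⟨c, hc1, hc2, hc3⟩ := piece (n := n) M hM lam0 hl0 hl a b hab hbn hbM s hs
    refine ⟨c, hc1, hc2, fun z => ?_⟩
    obtain ⟨N, Na, Nb, Nt, Nc⟩ := hc3 z
    refine ⟨N, Na, Nb, fun t hat htb => ?_, Nc⟩
    by_cases hend : N t = 0
    · refine ⟨?_, fun _ => hend⟩
      rw [hend, add_zero, abs_mul, abs_of_nonneg hl0]
      have := hw1 t hat htb
      nlinarith
    · have hta : a < t := lt_of_le_of_ne hat (by rintro rfl; exact hend Na)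
      have htb' : t < b := lt_of_le_of_ne htb (by rintro rfl; exact hend Nb)
      obtain ⟨h1, h2⟩ := hw2 t hta htb'
      refine ⟨?_, fun h => absurd h h2⟩
      have h3 : |lam0 * w t + N t| = |s * (lam0 * w t + N t)| := by rw [abs_mul, hs1, one_mul]
      rw [h3, abs_le]
      obtain ⟨h4, h5⟩ := Nt t hat htb
      have h6 := hw1 t hat htb
      have h7 : |s * w t| ≤ 1 := by rw [abs_mul, hs1, one_mul]; exact h6
      have h8 := (abs_le.1 h7).1
      constructor <;> nlinarith
  induction L using Nat.strong_induction_on with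
  | _ L ih =>
    intro a hab hw1 hw2
    by_cases hLM : L ≤ M
    · refine (hmk a b (by omega) hbn (by omega) hw1 hw2).mono ?_
      have : 0 ≤ (L : ℝ) / M := by positivity
      nlinarith
    · push Not at hLM
      have g1 := hmk a (a + M) (by omega) (by omega) (by omega) (fun t h1 h2 => hw1 t h1 (by omega)) (fun t h1 h2 => hw2 t h1 (by omega))
      have g2 := ih (L - M) (by omega) (a + M) (by omega) (fun t h1 h2 => hw1 t (by omega) h2) (fun t h1 h2 => hw2 t (by omega) h2)
      refine (g1.glue (by omega) (by omega) g2).mono (le_of_eq ?_)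
      rw [Nat.cast_sub hLM.le]
      field_simp
      ring

lemma mono_cut (f : ℕ → ℝ) (a b : ℕ) (hab : a ≤ b) (hf : ∀ s t, a ≤ s → s ≤ t → t ≤ b → f s ≤ f t) :
    ∃ c, a ≤ c ∧ c ≤ b ∧ (∀ t, a < t → t < c → f t ≤ 0) ∧ (∀ t, c < t → t < b → 0 ≤ f t) := by
  by_cases h : ∃ t, a ≤ t ∧ t ≤ b ∧ 0 < f t
  · classical
    obtain ⟨h1, h2, h3⟩ := Nat.find_spec h
    refine ⟨Nat.find h, h1, h2, fun t h4 h5 => ?_, fun t h4 h5 => ?_⟩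
    · have := Nat.find_min h h5
      push Not at this
      exact this h4.le (by omega)
    · exact h3.le.trans (hf _ t h1 h4.le h5.le)
  · push Not at h
    exact ⟨b, hab, le_rfl, fun t h1 h2 => h t h1.le h2.le, fun t h1 h2 => by omega⟩

lemma good_seg {n : ℕ} (w : ℕ → ℝ) (Brk : ℕ → Prop) (M : ℕ) (hM : 1 ≤ M) (lam0 : ℝ) (hl0 : 0 ≤ lam0)
    (hl : lam0 ^ 2 = 96 * M * (1 + Real.log M)) (a b : ℕ) (hab : a ≤ b) (hbn : b ≤ n)
    (hw1 : ∀ t, a ≤ t → t ≤ b → |w t| ≤ 1) (hB : ∀ t, a < t → t < b → ¬ Brk t)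
    (hw2 : ∃ τ : ℝ, τ ^ 2 = 1 ∧ ∀ s t, a ≤ s → s ≤ t → t ≤ b → τ * w s ≤ τ * w t) :
    Good n w Brk lam0 a b (400 * (1 + Real.log M) * (((b : ℝ) - a) / M + 2)) := by
  obtain ⟨τ, hτ, hm⟩ := hw2
  obtain ⟨c, hac, hcb, h1, h2⟩ := mono_cut (fun t => τ * w t) a b hab hm
  have g1 := good_half (n := n) w Brk M hM lam0 hl0 hl τ hτ c (by omega) (c - a) a (by omega) (fun t h3 h4 => hw1 t h3 (by omega))
    (fun t h3 h4 => ⟨h1 t h3 h4, hB t h3 (by omega)⟩)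
  have g2 := good_half (n := n) w Brk M hM lam0 hl0 hl (-τ) (by rw [neg_sq, hτ]) b hbn (b - c) c (by omega) (fun t h3 h4 => hw1 t (by omega) h4)
    (fun t h3 h4 => ⟨by have := h2 t h3 h4; linarith, hB t (by omega) h4⟩)
  refine (g1.glue hac hcb g2).mono (le_of_eq ?_)
  rw [Nat.cast_sub hac, Nat.cast_sub hcb]
  ring

/-! ### Linear interpolation of the signs -/

/-- Piecewise linear interpolation of `sg` at the breakpoints `p 0 < ... < p (k+1)`. -/
def wlin (k : ℕ) (p : ℕ → ℕ) (sg : ℕ → ℝ) (t : ℕ) : ℝ :=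
  sg (Nat.findGreatest (fun i => p i ≤ t) k) +
    ((t : ℝ) - p (Nat.findGreatest (fun i => p i ≤ t) k)) /
      ((p (Nat.findGreatest (fun i => p i ≤ t) k + 1) : ℝ) - p (Nat.findGreatest (fun i => p i ≤ t) k)) *
      (sg (Nat.findGreatest (fun i => p i ≤ t) k + 1) - sg (Nat.findGreatest (fun i => p i ≤ t) k))

section interp
variable {k : ℕ} {p : ℕ → ℕ} {sg : ℕ → ℝ}

lemma p_mono (hp : ∀ i ≤ k, p i < p (i + 1)) {i j : ℕ} (hij : i ≤ j) (hj : j ≤ k + 1) : p i ≤ p j := by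
  induction j, hij using Nat.le_induction with
  | base => exact le_rfl
  | succ j hij ih => exact (ih (by omega)).trans (hp j (by omega)).le

lemma fg_eq (hp : ∀ i ≤ k, p i < p (i + 1)) {i t : ℕ} (hi : i ≤ k) (h1 : p i ≤ t) (h2 : t < p (i + 1) ∨ i = k) :
    Nat.findGreatest (fun i => p i ≤ t) k = i := by
  rw [Nat.findGreatest_eq_iff]
  refine ⟨hi, fun _ => h1, fun j h3 h4 h5 => ?_⟩
  rcases h2 with h2 | h2
  · have := p_mono hp (show i + 1 ≤ j by omega) (by omega); omega
  · omega

lemma wlin_eq (hp : ∀ i ≤ k, p i < p (i + 1)) {i t : ℕ} (hi : i ≤ k) (h1 : p i ≤ t) (h2 : t ≤ p (i + 1)) :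
    wlin k p sg t = sg i + ((t : ℝ) - p i) / ((p (i + 1) : ℝ) - p i) * (sg (i + 1) - sg i) := by
  by_cases h3 : t < p (i + 1) ∨ i = k
  · unfold wlin; rw [fg_eq hp hi h1 h3]
  · push Not at h3
    have ht : t = p (i + 1) := by omega
    have hk : i + 1 ≤ k := by omega
    have : Nat.findGreatest (fun i => p i ≤ t) k = i + 1 :=
      fg_eq hp hk ht.ge (Or.inl (by rw [ht]; exact hp _ hk))
    unfold wlin; rw [this, ht]
    have h5 : (0:ℝ) < (p (i + 1) : ℝ) - p i := by
      have := hp i hi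
      rw [sub_pos]; exact_mod_cast this
    rw [div_self h5.ne']; simp

lemma exists_seg (hp : ∀ i ≤ k, p i < p (i + 1)) (hp0 : p 0 = 0) {t : ℕ} (ht : t < p (k + 1)) :
    ∃ i ≤ k, p i ≤ t ∧ t < p (i + 1) := by
  refine ⟨Nat.findGreatest (fun i => p i ≤ t) k, Nat.findGreatest_le _, ?_, ?_⟩
  · exact Nat.findGreatest_spec (P := fun i => p i ≤ t) (Nat.zero_le k) (by simp [hp0])
  · by_contra h
    push Not at h
    by_cases hk : Nat.findGreatest (fun i => p i ≤ t) k = k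
    · rw [hk] at h; omega
    · have h1 := Nat.findGreatest_le (P := fun i => p i ≤ t) k
      exact absurd h (Nat.findGreatest_is_greatest (P := fun i => p i ≤ t) (Nat.lt_succ_self _) (by omega))

lemma wlin_brk (hp : ∀ i ≤ k, p i < p (i + 1)) {i : ℕ} (hi : i ≤ k + 1) : wlin k p sg (p i) = sg i := by
  rcases Nat.lt_succ_iff_lt_or_eq.1 (Nat.lt_succ_of_le hi) with h | h
  · rw [wlin_eq hp (show i ≤ k by omega) le_rfl (hp i (by omega)).le]; simp
  · subst h
    rw [wlin_eq hp le_rfl (hp k le_rfl).le le_rfl]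
    have h5 : (0:ℝ) < (p (k + 1) : ℝ) - p k := by
      have := hp k le_rfl
      rw [sub_pos]; exact_mod_cast this
    rw [div_self h5.ne']; simp

lemma wlin_diff (hp : ∀ i ≤ k, p i < p (i + 1)) {i t : ℕ} (hi : i ≤ k) (h1 : p i ≤ t) (h2 : t < p (i + 1)) :
    wlin k p sg (t + 1) - wlin k p sg t = (sg (i + 1) - sg i) / ((p (i + 1) : ℝ) - p i) := by
  rw [wlin_eq hp hi h1 h2.le, wlin_eq hp hi (show p i ≤ t + 1 by omega) h2]
  push_cast; ring

lemma wlin_abs (hp : ∀ i ≤ k, p i < p (i + 1)) (hsg : ∀ i, |sg i| ≤ 1) {i t : ℕ} (hi : i ≤ k) (h1 : p i ≤ t) (h2 : t ≤ p (i + 1)) :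
    |wlin k p sg t| ≤ 1 := by
  rw [wlin_eq hp hi h1 h2]
  have h5 : (0:ℝ) < (p (i + 1) : ℝ) - p i := by
    have := hp i hi
    rw [sub_pos]; exact_mod_cast this
  set x := ((t : ℝ) - p i) / ((p (i + 1) : ℝ) - p i) with hx
  have h1r : (p i : ℝ) ≤ t := by exact_mod_cast h1
  have h2r : (t : ℝ) ≤ p (i + 1) := by exact_mod_cast h2
  have hx0 : 0 ≤ x := div_nonneg (by linarith) h5.le
  have hx1 : x ≤ 1 := by rw [hx, div_le_one h5]; linarith
  have ha := abs_le.1 (hsg i)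
  have hb := abs_le.1 (hsg (i + 1))
  rw [abs_le]
  constructor <;> nlinarith

lemma wlin_mono (hp : ∀ i ≤ k, p i < p (i + 1)) {i : ℕ} (hi : i ≤ k) :
    ∃ τ : ℝ, τ ^ 2 = 1 ∧ ∀ s t, p i ≤ s → s ≤ t → t ≤ p (i + 1) → τ * wlin k p sg s ≤ τ * wlin k p sg t := by
  have h5 : (0:ℝ) < (p (i + 1) : ℝ) - p i := by
    have := hp i hi
    rw [sub_pos]; exact_mod_cast this
  have key : ∀ τ : ℝ, 0 ≤ τ * (sg (i + 1) - sg i) → ∀ s t, p i ≤ s → s ≤ t → t ≤ p (i + 1) → τ * wlin k p sg s ≤ τ * wlin k p sg t := by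
    intro τ hτ s t h1 h2 h3
    rw [wlin_eq hp hi h1 (h2.trans h3), wlin_eq hp hi (h1.trans h2) h3]
    have h2r : (s : ℝ) ≤ t := by exact_mod_cast h2
    have : ((s : ℝ) - p i) / ((p (i + 1) : ℝ) - p i) ≤ ((t : ℝ) - p i) / ((p (i + 1) : ℝ) - p i) := by gcongr
    nlinarith
  rcases le_total (sg i) (sg (i + 1)) with h | h
  · exact ⟨1, by norm_num, key 1 (by linarith)⟩
  · exact ⟨-1, by norm_num, key (-1) (by linarith)⟩

lemma sum_segs (hp : ∀ i ≤ k, p i < p (i + 1)) (f : ℕ → ℝ) (m : ℕ) (hm : m ≤ k + 1) (hp0 : p 0 = 0) :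
    ∑ t ∈ Finset.range (p m), f t = ∑ i ∈ Finset.range m, ∑ t ∈ Finset.Ico (p i) (p (i + 1)), f t := by
  induction m with
  | zero => simp [hp0]
  | succ m ih =>
    rw [Finset.sum_range_succ, ← ih (by omega), Finset.range_eq_Ico, Finset.range_eq_Ico, Finset.sum_Ico_consecutive _ (Nat.zero_le _) (hp m (by omega)).le]

lemma wlin_energy (hp : ∀ i ≤ k, p i < p (i + 1)) (hp0 : p 0 = 0) :
    ∑ t ∈ Finset.range (p (k + 1)), (wlin k p sg (t + 1) - wlin k p sg t) ^ 2 =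
      ∑ i ∈ Finset.range (k + 1), (sg (i + 1) - sg i) ^ 2 / ((p (i + 1) : ℝ) - p i) := by
  rw [sum_segs hp _ (k + 1) le_rfl hp0]
  refine Finset.sum_congr rfl fun i hi => ?_
  rw [Finset.mem_range] at hi
  have hlt := hp i (by omega)
  have h5 : (0:ℝ) < (p (i + 1) : ℝ) - p i := by
    rw [sub_pos]; exact_mod_cast hlt
  have : ∀ t ∈ Finset.Ico (p i) (p (i + 1)), (wlin k p sg (t + 1) - wlin k p sg t) ^ 2 = ((sg (i + 1) - sg i) / ((p (i + 1) : ℝ) - p i)) ^ 2 := by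
    intro t ht
    rw [Finset.mem_Ico] at ht
    rw [wlin_diff hp (by omega) ht.1 ht.2]
  rw [Finset.sum_congr rfl this, Finset.sum_const, Nat.card_Ico, nsmul_eq_mul, Nat.cast_sub hlt.le]
  field_simp

lemma good_all {n : ℕ} (hp : ∀ i ≤ k, p i < p (i + 1)) (hp0 : p 0 = 0) (hpn : p (k + 1) = n) (hsg : ∀ i, |sg i| ≤ 1)
    (Brk : ℕ → Prop) (hBrk : ∀ t, Brk t → ∃ i, i ≤ k + 1 ∧ t = p i)
    (M : ℕ) (hM : 1 ≤ M) (lam0 : ℝ) (hl0 : 0 ≤ lam0)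
    (hl : lam0 ^ 2 = 96 * M * (1 + Real.log M)) :
    Good n (wlin k p sg) Brk lam0 0 n (400 * (1 + Real.log M) * ((n : ℝ) / M + 2 * (k + 1))) := by
  have key : ∀ m, 1 ≤ m → m ≤ k + 1 → Good n (wlin k p sg) Brk lam0 0 (p m) (400 * (1 + Real.log M) * ((p m : ℝ) / M + 2 * m)) := by
    have hseg : ∀ i ≤ k, Good n (wlin k p sg) Brk lam0 (p i) (p (i + 1)) (400 * (1 + Real.log M) * (((p (i + 1) : ℝ) - p i) / M + 2)) := by
      intro i hi
      refine good_seg _ Brk M hM lam0 hl0 hl (p i) (p (i + 1)) (hp i hi).le ?_ (fun t h1 h2 => wlin_abs hp hsg hi h1 h2) ?_ (wlin_mono hp hi)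
      · rw [← hpn]; exact p_mono hp (by omega) le_rfl
      · intro t h1 h2 hb
        obtain ⟨j, hj, rfl⟩ := hBrk t hb
        rcases Nat.lt_or_ge i j with h | h
        · have := p_mono hp (show i + 1 ≤ j from h) hj; omega
        · have := p_mono hp h (by omega); omega
    intro m hm
    induction m, hm using Nat.le_induction with
    | base =>
      intro _
      have := hseg 0 (Nat.zero_le _)
      rw [hp0] at this
      simpa using this
    | succ m hm ih =>
      intro hmk
      refine ((ih (by omega)).glue (Nat.zero_le _) (hp m (by omega)).le (hseg m (by omega))).mono (le_of_eq ?_)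
      push_cast
      ring
  have := key (k + 1) (by omega) le_rfl
  rw [hpn] at this
  exact_mod_cast this

end interp



/-! ### Knot data -/

/-- Zero-based knot positions. -/
def pk (n k : ℕ) (j : Fin k → ℕ) (i : ℕ) : ℕ := jext n 1 k j i - 1

lemma jext_mid {n k : ℕ} {j : Fin k → ℕ} (a : Fin k) : jext n 1 k j (a + 1) = j a := by
  simp [jext]

lemma jext_last {n k : ℕ} {j : Fin k → ℕ} : jext n 1 k j (k + 1) = n - 1 + 2 := by
  simp [jext]

lemma sgext_mid {k : ℕ} {sg : Fin k → ℝ} (a : Fin k) : sgext k sg (a + 1) = sg a := by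
  simp [sgext]

lemma sgext_last {k : ℕ} {sg : Fin k → ℝ} : sgext k sg (k + 1) = 0 := by
  simp [sgext]

lemma sgext_zero {k : ℕ} {sg : Fin k → ℝ} : sgext k sg 0 = 0 := by
  simp [sgext]

lemma mid_cases (k i : ℕ) : i = 0 ∨ (∃ a : Fin k, i = a + 1) ∨ k + 1 ≤ i := by
  rcases Nat.eq_zero_or_pos i with h | h
  · exact Or.inl h
  · by_cases h2 : i ≤ k
    · exact Or.inr (Or.inl ⟨⟨i - 1, by omega⟩, by simp; omega⟩)
    · exact Or.inr (Or.inr (by omega))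

section knots
variable {n k : ℕ} {θ : Fin n → ℝ} {j : Fin k → ℕ} {sg : Fin k → ℝ}

lemma kn_two (hk : 1 ≤ k) (h : IsKnotSeq 1 n θ k j sg) : 2 ≤ n := by
  have := h.2.1 ⟨0, hk⟩
  omega

lemma kn_zero : pk n k j 0 = 0 := by simp [pk, jext]

lemma kn_last (hk : 1 ≤ k) (h : IsKnotSeq 1 n θ k j sg) : pk n k j (k + 1) = n := by
  have := kn_two hk h
  unfold pk; rw [jext_last]; omega

lemma kn_jext_lt (h : IsKnotSeq 1 n θ k j sg) (i : ℕ) (hi : i ≤ k) :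
    1 ≤ jext n 1 k j i ∧ jext n 1 k j i < jext n 1 k j (i + 1) := by
  obtain ⟨h1, h2, -, -⟩ := h
  rcases mid_cases k i with rfl | ⟨a, rfl⟩ | h3
  · refine ⟨by simp [jext], ?_⟩
    have h0 : jext n 1 k j 0 = 1 := by simp [jext]
    rw [h0]
    rcases Nat.eq_zero_or_pos k with rfl | hk
    · rw [jext_last]; omega
    · have := h2 ⟨0, hk⟩
      have h4 := jext_mid (n := n) (j := j) ⟨0, hk⟩
      simp only at h4
      rw [h4]; omega
  · have ha := h2 a
    rw [jext_mid]
    refine ⟨by omega, ?_⟩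
    by_cases hlt : (a : ℕ) + 1 < k
    · have h4 := jext_mid (n := n) (j := j) ⟨a + 1, hlt⟩
      simp only at h4
      rw [h4]
      exact h1 (by simp [Fin.lt_def])
    · have : (a : ℕ) + 1 = k := by have := a.2; omega
      rw [this, jext_last]; omega
  · omega

lemma kn_lt (h : IsKnotSeq 1 n θ k j sg) : ∀ i ≤ k, pk n k j i < pk n k j (i + 1) := by
  intro i hi
  have := kn_jext_lt h i hi
  unfold pk; omega

lemma kn_len (h : IsKnotSeq 1 n θ k j sg) (i : ℕ) (hi : i ≤ k) :
    (nlen n 1 k j i : ℝ) = (pk n k j (i + 1) : ℝ) - pk n k j i := by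
  have h1 := kn_jext_lt h i hi
  have h2 : nlen n 1 k j i = pk n k j (i + 1) - pk n k j i := by
    unfold nlen pk
    split_ifs with h0
    · subst h0; simp [jext]
    · omega
  rw [h2, Nat.cast_sub (kn_lt h i hi).le]

lemma kn_le (hk : 1 ≤ k) (h : IsKnotSeq 1 n θ k j sg) : k + 1 ≤ n := by
  have key : ∀ i ≤ k + 1, i ≤ pk n k j i := by
    intro i
    induction i with
    | zero => simp
    | succ i ih =>
      intro hi
      have := kn_lt h i (by omega)
      have := ih (by omega)
      omega
  have := key (k + 1) le_rfl
  rwa [kn_last hk h] at this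

lemma kn_sg (h : IsKnotSeq 1 n θ k j sg) (a : Fin k) : sg a = 1 ∨ sg a = -1 := by
  rw [h.2.2.2 a]
  split_ifs <;> simp

lemma kn_sg_abs (h : IsKnotSeq 1 n θ k j sg) (i : ℕ) : |sgext k sg i| ≤ 1 := by
  unfold sgext
  split_ifs with h1
  · rcases kn_sg h ⟨i - 1, h1.2⟩ with h2 | h2 <;> rw [h2] <;> simp
  · simp

lemma kn_jump_sign (h : IsKnotSeq 1 n θ k j sg) {t : ℕ} (ht : t < n - 1) (hj : jmp θ t ≠ 0) :
    ∃ a : Fin k, t + 1 = pk n k j (a + 1) ∧ sg a * jmp θ t = |jmp θ t| := by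
  obtain ⟨h1, h2, h3, h4⟩ := h
  have hd : DD (1 - 1) θ = pad θ := rfl
  rw [hd] at h3 h4
  obtain ⟨a, ha⟩ := (h3 (t + 2) (by omega) (by omega)).1 (by
    intro he
    apply hj
    unfold jmp
    rw [sub_eq_zero]
    exact he.symm)
  refine ⟨a, by unfold pk; rw [jext_mid, ha]; rfl, ?_⟩
  rw [h4 a, ha]
  have e1 : t + 2 - 2 = t := rfl
  have e2 : t + 2 - 1 = t + 1 := rfl
  rw [e1, e2]
  unfold jmp
  split_ifs with h5
  · rw [one_mul, abs_of_pos (by linarith)]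
  · rw [abs_of_nonpos (by linarith)]; ring

lemma kn_is_jump (h : IsKnotSeq 1 n θ k j sg) {t : ℕ} (a : Fin k) (hta : t + 1 = pk n k j (a + 1)) :
    jmp θ t ≠ 0 := by
  obtain ⟨h1, h2, h3, h4⟩ := h
  have hd : DD (1 - 1) θ = pad θ := rfl
  rw [hd] at h3 h4
  have ha := h2 a
  have he : j a = t + 2 := by
    unfold pk at hta; rw [jext_mid] at hta; omega
  have := (h3 (t + 2) (by omega) (by omega)).2 ⟨a, he⟩
  intro h0
  apply this
  unfold jmp at h0
  have e1 : t + 2 - 2 = t := rfl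
  have e2 : t + 2 - 1 = t + 1 := rfl
  rw [e1, e2]; linarith

/-- The interpolating weight function. -/
def wk (n k : ℕ) (j : Fin k → ℕ) (sg : Fin k → ℝ) : ℕ → ℝ := wlin k (pk n k j) (sgext k sg)

lemma wk_zero (h : IsKnotSeq 1 n θ k j sg) : wk n k j sg 0 = 0 := by
  have := wlin_brk (sg := sgext k sg) (kn_lt h) (i := 0) (by omega)
  rwa [kn_zero, sgext_zero] at this

lemma wk_last (hk : 1 ≤ k) (h : IsKnotSeq 1 n θ k j sg) : wk n k j sg n = 0 := by
  have := wlin_brk (sg := sgext k sg) (kn_lt h) (i := k + 1) le_rfl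
  rwa [kn_last hk h, sgext_last] at this

lemma wk_mid (h : IsKnotSeq 1 n θ k j sg) (a : Fin k) : wk n k j sg (pk n k j (a + 1)) = sg a := by
  have := wlin_brk (sg := sgext k sg) (kn_lt h) (i := a + 1) (by omega)
  rwa [sgext_mid] at this

lemma vl_mem_gen (hk : 1 ≤ k) (h : IsKnotSeq 1 n θ k j sg) (W : ℕ → ℝ) (h0 : W 0 = 0) (hn : W n = 0)
    (hb : ∀ t ≤ n, |W t| ≤ 1) (hm : ∀ a : Fin k, W (pk n k j (a + 1)) = sg a) :
    negd W ∈ subdiff (fun α => Dl1 1 α) θ := by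
  refine negd_mem θ W h0 hn (fun t ht => hb _ (by omega)) ?_
  intro t ht
  by_cases hj : jmp θ t = 0
  · simp [hj]
  · obtain ⟨a, h1, h2⟩ := kn_jump_sign h ht hj
    rw [h1, hm a, h2]

lemma wk_abs (hk : 1 ≤ k) (h : IsKnotSeq 1 n θ k j sg) (t : ℕ) (ht : t ≤ n) : |wk n k j sg t| ≤ 1 := by
  rcases ht.eq_or_lt with rfl | ht
  · rw [wk_last hk h]; simp
  · obtain ⟨i, hi, h1, h2⟩ := exists_seg (kn_lt h) kn_zero (t := t) (by rw [kn_last hk h]; exact ht)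
    exact wlin_abs (kn_lt h) (kn_sg_abs h) hi h1 h2.le

lemma vl_mem (hk : 1 ≤ k) (h : IsKnotSeq 1 n θ k j sg) :
    negd (wk n k j sg) ∈ subdiff (fun α => Dl1 1 α) θ :=
  vl_mem_gen hk h _ (wk_zero h) (wk_last hk h) (wk_abs hk h) (wk_mid h)

lemma vl_jmp (hk : 1 ≤ k) (h : IsKnotSeq 1 n θ k j sg) (t : ℕ) (ht : t < n - 1) (hj : jmp θ t = 0) :
    jmp (negd (wk n k j sg) : Fin n → ℝ) t = 0 := by
  obtain ⟨i, hi, h1, h2⟩ := exists_seg (kn_lt h) kn_zero (t := t) (by rw [kn_last hk h]; omega)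
  have h3 : t + 1 < pk n k j (i + 1) := by
    refine lt_of_le_of_ne h2 ?_
    intro he
    rcases hi.eq_or_lt with rfl | hi'
    · rw [kn_last hk h] at he; omega
    · exact kn_is_jump h ⟨i, hi'⟩ he hj
  have d1 := wlin_diff (sg := sgext k sg) (kn_lt h) hi h1 h2
  have d2 := wlin_diff (sg := sgext k sg) (kn_lt h) hi (by omega) h3
  unfold jmp
  rw [pad_apply _ _ (by omega : t + 1 < n), pad_apply _ _ (by omega : t < n)]
  simp only [negd, wk]
  linarith

lemma vl_sq (hk : 1 ≤ k) (h : IsKnotSeq 1 n θ k j sg) :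
    sqnorm (negd (wk n k j sg) : Fin n → ℝ) =
      ∑ i ∈ Finset.range (k + 1), (sgext k sg (i + 1) - sgext k sg i) ^ 2 / (nlen n 1 k j i : ℝ) := by
  have e := wlin_energy (sg := sgext k sg) (kn_lt h) kn_zero
  rw [kn_last hk h, Finset.sum_range] at e
  have e2 : ∑ i ∈ Finset.range (k + 1), (sgext k sg (i + 1) - sgext k sg i) ^ 2 / (nlen n 1 k j i : ℝ) =
      ∑ i ∈ Finset.range (k + 1), (sgext k sg (i + 1) - sgext k sg i) ^ 2 / ((pk n k j (i + 1) : ℝ) - pk n k j i) := by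
    refine Finset.sum_congr rfl fun i hi => ?_
    rw [kn_len h i (by rw [Finset.mem_range] at hi; omega)]
  rw [e2, ← e]
  unfold sqnorm negd wk
  exact Finset.sum_congr rfl fun i _ => by ring

/-- The sum of inverse lengths over sign changes. -/
def Qk (n k : ℕ) (j : Fin k → ℕ) (sg : Fin k → ℝ) : ℝ :=
  ∑ i ∈ Finset.range (k + 1), (if sgext k sg i ≠ sgext k sg (i + 1) then 1 / (nlen n 1 k j i : ℝ) else 0)

lemma Qk_nonneg : 0 ≤ Qk n k j sg :=
  Finset.sum_nonneg fun i _ => by split_ifs <;> positivity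

lemma vl_sq_le (hk : 1 ≤ k) (h : IsKnotSeq 1 n θ k j sg) :
    sqnorm (negd (wk n k j sg) : Fin n → ℝ) ≤ 4 * Qk n k j sg := by
  rw [vl_sq hk h, Qk, Finset.mul_sum]
  refine Finset.sum_le_sum fun i _ => ?_
  split_ifs with h1
  · have a1 := abs_le.1 (kn_sg_abs h i)
    have a2 := abs_le.1 (kn_sg_abs h (i + 1))
    rw [mul_one_div]
    refine div_le_div_of_nonneg_right ?_ (Nat.cast_nonneg _)
    nlinarith
  · push Not at h1
    rw [h1]; simp

lemma vl_pos (hk : 1 ≤ k) (h : IsKnotSeq 1 n θ k j sg) : 0 < eunorm (negd (wk n k j sg) : Fin n → ℝ) := by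
  unfold eunorm
  rw [Real.sqrt_pos, vl_sq hk h]
  refine Finset.sum_pos' (fun i _ => by positivity) ⟨0, by simp, ?_⟩
  have h1 : sgext k sg (0 + 1) = sg ⟨0, hk⟩ := sgext_mid ⟨0, hk⟩
  have h2 : (sgext k sg (0 + 1) - sgext k sg 0) ^ 2 = 1 := by
    rw [h1, sgext_zero]
    rcases kn_sg h ⟨0, hk⟩ with h2 | h2 <;> rw [h2] <;> norm_num
  rw [h2, kn_len h 0 (by omega)]
  have := kn_lt h 0 (by omega)
  have h3 : (pk n k j 0 : ℝ) < pk n k j (0 + 1) := by exact_mod_cast this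
  exact div_pos one_pos (by linarith)

lemma dist_B (hk : 1 ≤ k) (h : IsKnotSeq 1 n θ k j sg) (M : ℕ) (hM : 1 ≤ M) (lam0 : ℝ) (hl0 : 0 < lam0)
    (hl : lam0 ^ 2 = 96 * M * (1 + Real.log M)) :
    ∫ z, distSet z (scaleSet lam0 (subdiff (fun α => Dl1 1 α) θ)) ^ 2 ∂gaussVec n 1 ≤
      2 * lam0 ^ 2 * sqnorm (negd (wk n k j sg) : Fin n → ℝ) +
        2 * (400 * (1 + Real.log M) * ((n : ℝ) / M + 2 * (k + 1))) := by
  obtain ⟨c, hc1, hc2, hc3⟩ := good_all (n := n) (sg := sgext k sg) (kn_lt h) kn_zero (kn_last hk h) (kn_sg_abs h)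
    (fun t => ∃ a : Fin k, t = pk n k j (a + 1)) (by
      rintro t ⟨a, ha⟩
      exact ⟨a + 1, by omega, ha⟩) M hM lam0 hl0.le hl
  set V := sqnorm (negd (wk n k j sg) : Fin n → ℝ) with hV
  have hpt : ∀ z, distSet z (scaleSet lam0 (subdiff (fun α => Dl1 1 α) θ)) ^ 2 ≤ 2 * lam0 ^ 2 * V + 2 * c z := by
    intro z
    obtain ⟨N, hN0, hNn, hN, hs⟩ := hc3 z
    have hmem : negd (fun t => (lam0 * wk n k j sg t + N t) / lam0) ∈ subdiff (fun α => Dl1 1 α) θ := by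
      refine vl_mem_gen hk h _ ?_ ?_ ?_ ?_
      · simp [wk_zero h, hN0]
      · simp [wk_last hk h, hNn]
      · intro t ht
        rw [abs_div, abs_of_pos hl0, div_le_one hl0]
        exact (hN t (Nat.zero_le _) ht).1
      · intro a
        have hle : pk n k j (a + 1) ≤ n := by
          have := p_mono (kn_lt h) (i := a + 1) (j := k + 1) (by omega) le_rfl
          rwa [kn_last hk h] at this
        rw [(hN _ (Nat.zero_le _) hle).2 ⟨a, rfl⟩, wk_mid h]
        field_simp
        ring
    have h1 := dist_le hmem z lam0
    have h2 := pow_le_pow_left₀ (dist_nonneg' z _) h1 2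
    rw [eunorm_sq] at h2
    refine h2.trans ?_
    have e1 : V = ∑ i : Fin n, (wk n k j sg i - wk n k j sg (i + 1)) ^ 2 := rfl
    rw [Nat.Ico_zero_eq_range, Finset.sum_range] at hs
    have : sqnorm (z - lam0 • negd (fun t => (lam0 * wk n k j sg t + N t) / lam0)) ≤
        2 * lam0 ^ 2 * V + 2 * ∑ i : Fin n, (pad z i + (N (i + 1) - N i)) ^ 2 := by
      rw [e1, Finset.mul_sum, Finset.mul_sum, ← Finset.sum_add_distrib]
      refine Finset.sum_le_sum fun i _ => ?_
      rw [pad_apply _ _ i.2]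
      have e3 : (z - lam0 • (negd (fun t => (lam0 * wk n k j sg t + N t) / lam0) : Fin n → ℝ)) i =
          z i + (N (i + 1) - N i) - lam0 * (wk n k j sg i - wk n k j sg (i + 1)) := by
        simp only [Pi.sub_apply, Pi.smul_apply, negd, smul_eq_mul]
        field_simp
        ring
      rw [e3]
      simp only [Fin.eta]
      nlinarith [sq_nonneg (z i + (N (i + 1) - N i) + lam0 * (wk n k j sg i - wk n k j sg (i + 1)))]
    linarith
  calc _ ≤ ∫ z, (2 * lam0 ^ 2 * V + 2 * c z) ∂gaussVec n 1 :=
        integral_mono_of_nonneg (Filter.Eventually.of_forall fun z => sq_nonneg _)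
          ((integrable_const _).add (hc1.const_mul 2)) (Filter.Eventually.of_forall hpt)
    _ = 2 * lam0 ^ 2 * V + 2 * ∫ z, c z ∂gaussVec n 1 := by
        rw [integral_add (integrable_const _) (hc1.const_mul 2)]; simp [integral_const_mul]
    _ ≤ _ := by linarith

end knots



/-! ### Final estimates -/

lemma log_form {n k : ℕ} (hn : k + 1 ≤ n) :
    Real.log (Real.exp 1 * (n : ℝ) / ((k : ℝ) + 1)) = 1 + Real.log ((n : ℝ) / ((k : ℝ) + 1)) ∧
      1 ≤ (n : ℝ) / ((k : ℝ) + 1) ∧ 1 ≤ Real.log (Real.exp 1 * (n : ℝ) / ((k : ℝ) + 1)) := by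
  have hk : (0 : ℝ) < (k : ℝ) + 1 := by positivity
  have hx : 1 ≤ (n : ℝ) / ((k : ℝ) + 1) := by
    rw [le_div_iff₀ hk, one_mul]; exact_mod_cast hn
  have h1 : Real.log (Real.exp 1 * (n : ℝ) / ((k : ℝ) + 1)) = 1 + Real.log ((n : ℝ) / ((k : ℝ) + 1)) := by
    rw [mul_div_assoc, Real.log_mul (Real.exp_pos 1).ne' (by linarith), Real.log_exp]
  refine ⟨h1, hx, ?_⟩
  rw [h1]
  linarith [Real.log_nonneg hx]

lemma arith_fin (l V a b y x L Q D K : ℝ) (b1 : l * V ≤ 1536 * (x * L * Q)) (b2 : a * (y + b) ≤ 2 * L * (3 * K))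
    (b3 : D * V ≤ 4 * (D * Q)) (b4 : 2 ≤ L * K) (b5 : 0 ≤ x * L * Q) (b6 : 0 ≤ D * Q) :
    10 * (2 * l * V + 2 * (400 * a * (y + b)) + D * V + 8) + 2 ≤ 50000 * (K * L + Q * x * L + D * Q) := by
  have e1 : 2 * l * V = 2 * (l * V) := by ring
  have e2 : 2 * (400 * a * (y + b)) = 800 * (a * (y + b)) := by ring
  have e3 : K * L + Q * x * L + D * Q = L * K + x * L * Q + D * Q := by ring
  rw [e1, e2, e3]
  linarith

lemma core_bound {n k : ℕ} {θ : Fin n → ℝ} {j : Fin k → ℕ} {sg : Fin k → ℝ} (hk : 1 ≤ k)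
    (h : IsKnotSeq 1 n θ k j sg) (σ : ℝ) (hσ : 0 < σ) (v0 : Fin n → ℝ)
    (hv0 : IsMinNormIn v0 ((affineSpan ℝ (subdiff (fun α => Dl1 1 α) θ) : Set (Fin n → ℝ))))
    (lamfun : (Fin n → ℝ) → ℝ) (hlam : IsLamFun (subdiff (fun α => Dl1 1 α) θ) lamfun)
    (lamstar : ℝ) (hls : lamstar = (∫ z, lamfun z ∂gaussVec n 1) + 2 / eunorm v0)
    (lam : ℝ) (hl : lamstar ≤ lam) (est : (Fin n → ℝ) → Fin n → ℝ) (he : IsPenEst 1 σ lam est) :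
    risk σ est θ ≤ 50000 * σ ^ 2 *
      (((k : ℝ) + 1) / (n : ℝ) * Real.log (Real.exp 1 * (n : ℝ) / ((k : ℝ) + 1)) +
        Qk n k j sg / (n : ℝ) * ((n : ℝ) / ((k : ℝ) + 1)) * Real.log (Real.exp 1 * (n : ℝ) / ((k : ℝ) + 1)) +
        (lam - lamstar) ^ 2 / (n : ℝ) * Qk n k j sg) := by
  have hn := kn_le hk h
  obtain ⟨hL, hx, hL1⟩ := log_form hn
  set x : ℝ := (n : ℝ) / ((k : ℝ) + 1) with hxd
  set L := Real.log (Real.exp 1 * (n : ℝ) / ((k : ℝ) + 1)) with hLd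
  have hk0 : (0 : ℝ) < (k : ℝ) + 1 := by positivity
  have hnp : (0 : ℝ) < n := by
    have : 0 < n := by omega
    exact_mod_cast this
  have hQ : 0 ≤ Qk n k j sg := Qk_nonneg
  set Q := Qk n k j sg with hQd
  -- the scale
  set M : ℕ := n / (k + 1) + 1 with hMd
  have hM : 1 ≤ M := Nat.le_add_left _ _
  have hM1 : (1 : ℝ) ≤ M := by exact_mod_cast hM
  have hMx : (M : ℝ) ≤ 2 * x := by
    have : ((n / (k + 1) : ℕ) : ℝ) ≤ (n : ℝ) / ((k + 1 : ℕ) : ℝ) := Nat.cast_div_le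
    push_cast at this
    rw [hMd]; push_cast
    linarith
  have hnM : (n : ℝ) / M ≤ (k : ℝ) + 1 := by
    rw [div_le_iff₀ (by linarith)]
    have h1 : n < (k + 1) * M := by
      rw [hMd]; exact Nat.lt_mul_div_succ n (by omega)
    have h2 : (n : ℝ) < ((k + 1) * M : ℕ) := by exact_mod_cast h1
    push_cast at h2
    exact h2.le
  have hlogM0 : 0 ≤ Real.log M := Real.log_nonneg hM1
  have hlogM : 1 + Real.log M ≤ 2 * L := by
    have h1 : Real.log M ≤ Real.log (2 * x) := Real.log_le_log (by linarith) hMx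
    rw [Real.log_mul (by norm_num) (by linarith)] at h1
    have h2 : Real.log 2 ≤ 1 := by linarith [Real.log_two_lt_d9]
    have h3 := Real.log_nonneg hx
    linarith
  set lam0 := Real.sqrt (96 * M * (1 + Real.log M)) with hl0d
  have hpos : 0 < 96 * (M : ℝ) * (1 + Real.log M) := by positivity
  have hl0 : 0 < lam0 := Real.sqrt_pos.2 hpos
  have hl0s : lam0 ^ 2 = 96 * M * (1 + Real.log M) := Real.sq_sqrt hpos.le
  have hB := dist_B hk h M hM lam0 hl0 hl0s
  obtain ⟨hv, hv0d⟩ := v0_eq θ (negd (wk n k j sg)) v0 (vl_jmp hk h) (vl_mem hk h) hv0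
  have hV4 := vl_sq_le hk h
  rw [← hv] at hB hV4
  have hmem : v0 ∈ subdiff (fun α => Dl1 1 α) θ := hv ▸ vl_mem hk h
  have hvp : 0 < eunorm v0 := hv ▸ vl_pos hk h
  obtain ⟨hlp, hintg, hfin⟩ := combine (sub_compact _ θ) (sub_convex _ θ) v0 hmem hv0d hvp lamfun hlam
    lamstar lam lam0 _ hls hl hl0.le hB
  have hr := risk_bound σ lam hσ hlp.le est he θ ⟨v0, hmem⟩ hintg
  set D := (lam - lamstar) ^ 2 with hD
  have hD0 : 0 ≤ D := sq_nonneg _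
  set V := sqnorm v0 with hVd
  have hV0 : 0 ≤ V := sqnorm_nonneg _
  have b1 : lam0 ^ 2 * V ≤ 1536 * (x * L * Q) := by
    rw [hl0s]
    calc 96 * (M : ℝ) * (1 + Real.log M) * V ≤ 96 * (2 * x) * (2 * L) * (4 * Q) := by gcongr
      _ = 1536 * (x * L * Q) := by ring
  have b2 : (1 + Real.log M) * ((n : ℝ) / M + 2 * (k + 1)) ≤ 2 * L * (3 * (k + 1)) := by
    gcongr
    linarith
  have b3 : D * V ≤ 4 * (D * Q) := by nlinarith
  have b4 : 2 ≤ L * ((k : ℝ) + 1) := by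
    have : (1 : ℝ) ≤ k := by exact_mod_cast hk
    nlinarith
  have b5 : 0 ≤ x * L * Q := by positivity
  have b6 : 0 ≤ D * Q := by positivity
  have hfin2 : ∫ z, distSet z (scaleSet lam (subdiff (fun α => Dl1 1 α) θ)) ^ 2 ∂gaussVec n 1 ≤
      50000 * (((k : ℝ) + 1) * L + Q * x * L + D * Q) := by
    exact hfin.trans (arith_fin _ V _ _ _ x L Q D _ b1 b2 b3 b4 b5 b6)
  refine hr.trans ?_
  calc _ ≤ σ ^ 2 / n * (50000 * (((k : ℝ) + 1) * L + Q * x * L + D * Q)) := by gcongr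
    _ = _ := by field_simp

lemma Qk_le_delta {n k : ℕ} {θ : Fin n → ℝ} {j : Fin k → ℕ} {sg : Fin k → ℝ} (hk : 1 ≤ k)
    (h : IsKnotSeq 1 n θ k j sg) : Qk n k j sg ≤ deltaSq n 1 k j sg := by
  have hn := kn_le hk h
  have hx := (log_form hn).2.1
  have key : ∀ i ≤ k, 1 / (nlen n 1 k j i : ℝ) ≤ nstar n 1 k j i ^ (1 - 2 * ((1 : ℕ) : ℤ)) := by
    intro i hi
    have hpos : (0 : ℝ) < nlen n 1 k j i := by
      rw [kn_len h i hi]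
      have : (pk n k j i : ℝ) < pk n k j (i + 1) := by exact_mod_cast kn_lt h i hi
      linarith
    have e : (1 - 2 * ((1 : ℕ) : ℤ)) = -1 := by norm_num
    rw [e, zpow_neg_one, one_div]
    have h1 : nstar n 1 k j i ≤ nlen n 1 k j i := min_le_left _ _
    have h2 : 0 < nstar n 1 k j i := lt_min hpos (by linarith)
    exact inv_anti₀ h2 h1
  have key0 : ∀ i ≤ k, (0 : ℝ) ≤ nstar n 1 k j i ^ (1 - 2 * ((1 : ℕ) : ℤ)) := fun i hi =>
    le_trans (by positivity) (key i hi)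
  have key' : ∀ i ≤ k, (if sgext k sg i ≠ sgext k sg (i + 1) then 1 / (nlen n 1 k j i : ℝ) else 0) ≤
      nstar n 1 k j i ^ (1 - 2 * ((1 : ℕ) : ℤ)) := by
    intro i hi
    split_ifs
    · exact key i hi
    · exact key0 i hi
  unfold Qk deltaSq
  rw [Finset.sum_range_succ, Finset.range_eq_Ico, Finset.sum_eq_sum_Ico_succ_bot (by omega)]
  have h0 := key' 0 (by omega)
  have hkk := key' k le_rfl
  have hs : ∑ i ∈ Finset.Ico (0 + 1) k, (if sgext k sg i ≠ sgext k sg (i + 1) then 1 / (nlen n 1 k j i : ℝ) else 0) ≤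
      ∑ i ∈ Finset.Ico 1 k,
        if sgext k sg i ≠ sgext k sg (i + 1) then nstar n 1 k j i ^ (1 - 2 * ((1 : ℕ) : ℤ)) else 0 := by
    refine Finset.sum_le_sum fun i hi => ?_
    rw [Finset.mem_Ico] at hi
    split_ifs
    · exact key i (by omega)
    · exact le_rfl
  linarith

lemma Qk_le_min {n k : ℕ} {θ : Fin n → ℝ} {j : Fin k → ℕ} {sg : Fin k → ℝ} (hk : 1 ≤ k)
    (h : IsKnotSeq 1 n θ k j sg) (c : ℝ) (hc : 0 < c) (hm : MinLen n 1 k j sg c) :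
    Qk n k j sg ≤ 1 / c * (((k : ℝ) + 1) / n) * ∑ i ∈ Finset.range (k + 1),
      (if sgext k sg i ≠ sgext k sg (i + 1) then (1 : ℝ) else 0) := by
  have hn := kn_le hk h
  have hnp : (0 : ℝ) < n := by
    have : 0 < n := by omega
    exact_mod_cast this
  unfold Qk
  rw [Finset.mul_sum]
  refine Finset.sum_le_sum fun i hi => ?_
  rw [Finset.mem_range] at hi
  split_ifs with h1
  · have h2 := hm i (by omega) h1
    have h3 : (0 : ℝ) < c * n / ((k : ℝ) + 1) := by positivity
    calc 1 / (nlen n 1 k j i : ℝ) ≤ 1 / (c * n / ((k : ℝ) + 1)) := one_div_le_one_div_of_le h3 h2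
      _ = _ := by field_simp
  · simp


lemma part_one {n k : ℕ} {θ : Fin n → ℝ} {j : Fin k → ℕ} {sg : Fin k → ℝ} (hk : 1 ≤ k)
    (h : IsKnotSeq 1 n θ k j sg) (D : ℝ) :
    ((k : ℝ) + 1) / (n : ℝ) * Real.log (Real.exp 1 * (n : ℝ) / ((k : ℝ) + 1)) +
        Qk n k j sg / (n : ℝ) * ((n : ℝ) / ((k : ℝ) + 1)) * Real.log (Real.exp 1 * (n : ℝ) / ((k : ℝ) + 1)) +
        D / (n : ℝ) * Qk n k j sg ≤ DeltaR n 1 k j sg + D / (n : ℝ) * Qk n k j sg := by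
  obtain ⟨hL, hx, hL1⟩ := log_form (kn_le hk h)
  have hQ := Qk_le_delta hk h
  have e : (2 * ((1 : ℕ) : ℤ) - 1) = 1 := by norm_num
  have h3 : 0 ≤ (Real.sqrt (deltaSq n 1 k j sg) / Real.sqrt (n : ℝ)) ^ ((1 : ℝ) / ((1 : ℕ) : ℝ)) := by positivity
  unfold DeltaR
  rw [e, zpow_one]
  have h4 : Qk n k j sg / (n : ℝ) * ((n : ℝ) / ((k : ℝ) + 1)) * Real.log (Real.exp 1 * (n : ℝ) / ((k : ℝ) + 1)) ≤
      deltaSq n 1 k j sg / (n : ℝ) * ((n : ℝ) / ((k : ℝ) + 1)) * Real.log (Real.exp 1 * (n : ℝ) / ((k : ℝ) + 1)) := by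
    gcongr
  linarith

lemma part_two {n k : ℕ} {θ : Fin n → ℝ} {j : Fin k → ℕ} {sg : Fin k → ℝ} (hk : 1 ≤ k)
    (h : IsKnotSeq 1 n θ k j sg) (c : ℝ) (hc : 0 < c) (hc1 : c ≤ 1) (hm : MinLen n 1 k j sg c) (D : ℝ) (hD : 0 ≤ D) :
    ((k : ℝ) + 1) / (n : ℝ) * Real.log (Real.exp 1 * (n : ℝ) / ((k : ℝ) + 1)) +
        Qk n k j sg / (n : ℝ) * ((n : ℝ) / ((k : ℝ) + 1)) * Real.log (Real.exp 1 * (n : ℝ) / ((k : ℝ) + 1)) +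
        D / (n : ℝ) * Qk n k j sg ≤
      2 / c * (((k : ℝ) + 1) / (n : ℝ) * Real.log (Real.exp 1 * (n : ℝ) / ((k : ℝ) + 1)) +
        D * (((k : ℝ) + 1) / (n : ℝ) ^ 2) * ∑ i ∈ Finset.range (k + 1),
          (if sgext k sg i ≠ sgext k sg (i + 1) then (1 : ℝ) else 0)) := by
  have hn := kn_le hk h
  obtain ⟨hL, hx, hL1⟩ := log_form hn
  have hQ := Qk_le_min hk h c hc hm
  have hnp : (0 : ℝ) < n := by
    have : 0 < n := by omega
    exact_mod_cast this
  set L := Real.log (Real.exp 1 * (n : ℝ) / ((k : ℝ) + 1))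
  set T := ∑ i ∈ Finset.range (k + 1), (if sgext k sg i ≠ sgext k sg (i + 1) then (1 : ℝ) else 0) with hT
  have hT0 : 0 ≤ T := Finset.sum_nonneg fun i _ => by split_ifs <;> norm_num
  have hT1 : T ≤ (k : ℝ) + 1 := by
    calc T ≤ ∑ i ∈ Finset.range (k + 1), (1 : ℝ) := Finset.sum_le_sum fun i _ => by split_ifs <;> norm_num
      _ = (k : ℝ) + 1 := by simp
  have hk0 : (0 : ℝ) < (k : ℝ) + 1 := by positivity
  have h1c : 1 ≤ 1 / c := by rw [le_div_iff₀ hc]; linarith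
  have t2 : Qk n k j sg / (n : ℝ) * ((n : ℝ) / ((k : ℝ) + 1)) * L ≤ 1 / c * (((k : ℝ) + 1) / n * L) := by
    calc Qk n k j sg / (n : ℝ) * ((n : ℝ) / ((k : ℝ) + 1)) * L
        ≤ (1 / c * (((k : ℝ) + 1) / n) * ((k : ℝ) + 1)) / (n : ℝ) * ((n : ℝ) / ((k : ℝ) + 1)) * L := by
          gcongr
          exact hQ.trans (by gcongr)
      _ = _ := by field_simp
  have t3 : D / (n : ℝ) * Qk n k j sg ≤ 1 / c * (D * (((k : ℝ) + 1) / (n : ℝ) ^ 2) * T) := by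
    calc D / (n : ℝ) * Qk n k j sg ≤ D / (n : ℝ) * (1 / c * (((k : ℝ) + 1) / n) * T) := by gcongr
      _ = _ := by field_simp
  have t1 : ((k : ℝ) + 1) / (n : ℝ) * L ≤ 1 / c * (((k : ℝ) + 1) / n * L) :=
    le_mul_of_one_le_left (by positivity) h1c
  have t4 : 0 ≤ 1 / c * (D * (((k : ℝ) + 1) / (n : ℝ) ^ 2) * T) := by positivity
  have e : 2 / c = 1 / c + 1 / c := by ring
  rw [e]
  linarith



/-- Corollary: risk of the penalized estimator for `r = 1`.  Here
`λ* = E λ_{θ*}(Z) + 2/‖v_0‖`. -/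
theorem stmt7 :
    (∃ C : ℝ, 0 < C ∧
      ∀ (n : ℕ) (σ : ℝ), 0 < σ → ∀ θstar : Fin n → ℝ,
        ∀ (k : ℕ), 1 ≤ k → ∀ (j : Fin k → ℕ) (sg : Fin k → ℝ), IsKnotSeq 1 n θstar k j sg →
        ∀ v0 : Fin n → ℝ,
          IsMinNormIn v0
            ((affineSpan ℝ (subdiff (fun α => Dl1 1 α) θstar) : Set (Fin n → ℝ))) →
        ∀ lamfun : (Fin n → ℝ) → ℝ, IsLamFun (subdiff (fun α => Dl1 1 α) θstar) lamfun →
        ∀ lamstar : ℝ, lamstar = (∫ z, lamfun z ∂gaussVec n 1) + 2 / eunorm v0 →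
        ∀ lam : ℝ, lamstar ≤ lam →
        ∀ est : (Fin n → ℝ) → Fin n → ℝ, IsPenEst 1 σ lam est →
          risk σ est θstar ≤
            C * σ ^ 2 * (DeltaR n 1 k j sg +
              (lam - lamstar) ^ 2 / (n : ℝ) * ∑ i ∈ Finset.range (k + 1),
                (if sgext k sg i ≠ sgext k sg (i + 1) then 1 / (nlen n 1 k j i : ℝ)
                  else 0))) ∧
    ∀ c : ℝ, 0 < c → c ≤ 1 →
      ∃ Cc : ℝ, 0 < Cc ∧
        ∀ (n : ℕ) (σ : ℝ), 0 < σ → ∀ θstar : Fin n → ℝ,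
          ∀ (k : ℕ), 1 ≤ k → ∀ (j : Fin k → ℕ) (sg : Fin k → ℝ),
            IsKnotSeq 1 n θstar k j sg → MinLen n 1 k j sg c →
          ∀ v0 : Fin n → ℝ,
            IsMinNormIn v0
              ((affineSpan ℝ (subdiff (fun α => Dl1 1 α) θstar) : Set (Fin n → ℝ))) →
          ∀ lamfun : (Fin n → ℝ) → ℝ, IsLamFun (subdiff (fun α => Dl1 1 α) θstar) lamfun →
          ∀ lamstar : ℝ, lamstar = (∫ z, lamfun z ∂gaussVec n 1) + 2 / eunorm v0 →
          ∀ lam : ℝ, lamstar ≤ lam →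
          ∀ est : (Fin n → ℝ) → Fin n → ℝ, IsPenEst 1 σ lam est →
            risk σ est θstar ≤
              Cc * σ ^ 2 * (((k : ℝ) + 1) / (n : ℝ) *
                  Real.log (Real.exp 1 * (n : ℝ) / ((k : ℝ) + 1)) +
                (lam - lamstar) ^ 2 * (((k : ℝ) + 1) / (n : ℝ) ^ 2) *
                  ∑ i ∈ Finset.range (k + 1),
                    (if sgext k sg i ≠ sgext k sg (i + 1) then (1 : ℝ) else 0)) := by
  refine ⟨⟨50000, by norm_num, ?_⟩, ?_⟩
  · intro n σ hσ θ k hk j sg h v0 hv0 lamfun hlam lamstar hls lam hl est he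
    refine (core_bound hk h σ hσ v0 hv0 lamfun hlam lamstar hls lam hl est he).trans ?_
    exact mul_le_mul_of_nonneg_left (part_one hk h _) (by positivity)
  · intro c hc hc1
    refine ⟨50000 * (2 / c), by positivity, ?_⟩
    intro n σ hσ θ k hk j sg h hm v0 hv0 lamfun hlam lamstar hls lam hl est he
    refine (core_bound hk h σ hσ v0 hv0 lamfun hlam lamstar hls lam hl est he).trans ?_
    have h1 := mul_le_mul_of_nonneg_left (part_two hk h c hc hc1 hm ((lam - lamstar) ^ 2) (sq_nonneg _))
      (by positivity : (0 : ℝ) ≤ 50000 * σ ^ 2)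
    refine h1.trans (le_of_eq ?_)
    ring
end
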